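/- arXiv:0809.2992 — 3 statements merged into one kernel-verified Lean document; each statement's English description precedes it below -/
import Mathlib

section
/- Let N^m_fin-pyramid(n0,n1) denote the number of finite type pyramid partitions of length m with n0 white stones and n1 black stones, and Z^m_fin-pyramid(p) = Σ N^m_fin-pyramid(n0,n1) p0^{n0} p1^{n1} its generating function. Then Z^m_fin-pyramid(p) = ∏_{m'=1}^{m} (1 + p0^{m−m'} p1^{m−m'+1})^{m'}. -/
/-- A finite type pyramid partition of length `m` (Chuang–Jafferis).

The empty room configuration of finite type and length `m` consists of
alternating layers of black and white stones: for `0 ≤ k ≤ m−1` the black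
layer `2k` is an `(m−k) × (k+1)` grid of stones `(k, i, j)`
(`i < m−k`, `j ≤ k`), and for `0 ≤ k ≤ m−2` the white layer `2k+1` is an
`(m−1−k) × (k+1)` grid of stones `(k, x, y)` (`x < m−1−k`, `y ≤ k`).
The white stone `(k, x, y)` rests on the black stones `(k, x, y)` and
`(k, x+1, y)` of the layer above it, and the black stone `(k+1, i, j)`
rests on those of the white stones `(k, i, j−1)`, `(k, i, j)` that exist.

A pyramid partition is a set of stones that can be removed from the
configuration: a stone may be removed only if all stones resting on it
(i.e. the stones of the previous layer touching it) are removed. -/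
structure FinPyramidPartition (m : ℕ) where
  whites : Finset (ℕ × ℕ × ℕ)
  blacks : Finset (ℕ × ℕ × ℕ)
  whites_mem : ∀ p ∈ whites, p.2.1 + p.1 + 2 ≤ m ∧ p.2.2 ≤ p.1
  blacks_mem : ∀ p ∈ blacks, p.2.1 + p.1 + 1 ≤ m ∧ p.2.2 ≤ p.1
  whites_closed : ∀ p ∈ whites, ∀ i : ℕ, (i = p.2.1 ∨ i = p.2.1 + 1) →
    (p.1, i, p.2.2) ∈ blacks
  blacks_closed : ∀ p ∈ blacks, ∀ k y : ℕ, p.1 = k + 1 →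
    (y + 1 = p.2.2 ∨ y = p.2.2) → y ≤ k → (k, p.2.1, y) ∈ whites

/-- `N^m_fin-pyramid(n0, n1)`: the number of finite type pyramid partitions
of length `m` with `n0` white stones and `n1` black stones. -/
noncomputable def finPyramidCount (m n0 n1 : ℕ) : ℕ :=
  Nat.card {P : FinPyramidPartition m //
    P.whites.card = n0 ∧ P.blacks.card = n1}

/-- The generating function
`Z^m_fin-pyramid(p) = Σ N^m_fin-pyramid(n0,n1) p0^{n0} p1^{n1}`. -/
noncomputable def finPyramidZ (m : ℕ) : MvPowerSeries (Fin 2) ℤ :=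
  fun d => (finPyramidCount m (d 0) (d 1) : ℤ)

namespace FinPyramid

open Finset

/-- The positions of the black stones in the empty room configuration of length `n`; the white
stones occupy `sites (n - 1)`. -/
def sites (n : ℕ) : Finset (ℕ × ℕ × ℕ) :=
  (range n ×ˢ range n ×ˢ range n).filter fun p => p.2.1 + p.1 + 1 ≤ n ∧ p.2.2 ≤ p.1

theorem mem_sites {n : ℕ} {p : ℕ × ℕ × ℕ} :
    p ∈ sites n ↔ p.2.1 + p.1 + 1 ≤ n ∧ p.2.2 ≤ p.1 := by
  simp only [sites, mem_filter, mem_product, mem_range]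
  omega

/-- The condition that every black stone covering a removed white stone is removed. -/
def WhitesClosed (W B : Finset (ℕ × ℕ × ℕ)) : Prop :=
  ∀ p ∈ W, ∀ i : ℕ, (i = p.2.1 ∨ i = p.2.1 + 1) → (p.1, i, p.2.2) ∈ B

/-- The condition that every white stone covering a removed black stone is removed. -/
def BlacksClosed (W B : Finset (ℕ × ℕ × ℕ)) : Prop :=
  ∀ p ∈ B, ∀ k y : ℕ, p.1 = k + 1 → (y + 1 = p.2.2 ∨ y = p.2.2) → y ≤ k → (k, p.2.1, y) ∈ W

open Classical in
/-- The pairs (white stones, black stones) forming a pyramid partition of length `m`. -/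
noncomputable def configs (m : ℕ) : Finset (Finset (ℕ × ℕ × ℕ) × Finset (ℕ × ℕ × ℕ)) :=
  ((sites (m - 1)).powerset ×ˢ (sites m).powerset).filter fun q =>
    WhitesClosed q.1 q.2 ∧ BlacksClosed q.1 q.2

theorem mem_configs {m : ℕ} {q : Finset (ℕ × ℕ × ℕ) × Finset (ℕ × ℕ × ℕ)} :
    q ∈ configs m ↔ (q.1 ⊆ sites (m - 1) ∧ q.2 ⊆ sites m) ∧
      WhitesClosed q.1 q.2 ∧ BlacksClosed q.1 q.2 := by
  simp [configs]

/-- Pyramid partitions as pairs of finite sets. -/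
def equivConfigs (m : ℕ) : FinPyramidPartition m ≃ configs m where
  toFun P := ⟨(P.whites, P.blacks), by
    refine mem_configs.2 ⟨⟨fun p hp => ?_, fun p hp => mem_sites.2 (P.blacks_mem p hp)⟩,
      P.whites_closed, P.blacks_closed⟩
    have := P.whites_mem p hp
    exact mem_sites.2 (by omega)⟩
  invFun q :=
    { whites := q.1.1
      blacks := q.1.2
      whites_mem := fun p hp => by
        have := mem_sites.1 ((mem_configs.1 q.2).1.1 hp)
        omega
      blacks_mem := fun p hp => mem_sites.1 ((mem_configs.1 q.2).1.2 hp)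
      whites_closed := (mem_configs.1 q.2).2.1
      blacks_closed := (mem_configs.1 q.2).2.2 }
  left_inv _ := rfl
  right_inv _ := rfl

/-- The weighted sum over pyramid partitions, evaluated in a semiring. -/
noncomputable def weight {R : Type*} [CommSemiring R] (m : ℕ) (a b : R) : R :=
  ∑ q ∈ configs m, a ^ q.1.card * b ^ q.2.card

theorem map_weight {R S : Type*} [CommSemiring R] [CommSemiring S] (f : R →+* S) (m : ℕ)
    (a b : R) : f (weight m a b) = weight m (f a) (f b) := by
  simp [weight]

theorem finPyramidCount_eq (m n0 n1 : ℕ) :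
    finPyramidCount m n0 n1 =
      ((configs m).filter fun q => q.1.card = n0 ∧ q.2.card = n1).card := by
  rw [finPyramidCount, ← Fintype.card_coe, ← Nat.card_eq_fintype_card]
  exact Nat.card_congr <|
    ((equivConfigs m).subtypeEquiv (q := fun q => q.1.1.card = n0 ∧ q.1.2.card = n1)
      fun _ => Iff.rfl).trans <|
    (Equiv.subtypeSubtypeEquivSubtypeInter (· ∈ configs m)
      fun q => q.1.card = n0 ∧ q.2.card = n1).trans <|
    Equiv.subtypeEquivRight fun _ => by rw [mem_filter]

theorem finPyramidZ_eq_weight (m : ℕ) :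
    finPyramidZ m = weight m (MvPowerSeries.X 0) (MvPowerSeries.X 1) := by
  classical
  ext d
  have h (q : Finset (ℕ × ℕ × ℕ) × Finset (ℕ × ℕ × ℕ)) :
      d = Finsupp.single 0 q.1.card + Finsupp.single 1 q.2.card ↔
        q.1.card = d 0 ∧ q.2.card = d 1 := by
    rw [Finsupp.ext_iff, Fin.forall_fin_two]
    simp [eq_comm]
  have hZ : MvPowerSeries.coeff d (finPyramidZ m) = (finPyramidCount m (d 0) (d 1) : ℤ) := rfl
  simp only [hZ, finPyramidCount_eq, weight, map_sum, MvPowerSeries.X_pow_eq,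
    MvPowerSeries.monomial_mul_monomial, MvPowerSeries.coeff_monomial, h]
  simp

/-- The black stones that have to be removed before the white stones in `W`. -/
def minBlacks (W : Finset (ℕ × ℕ × ℕ)) : Finset (ℕ × ℕ × ℕ) :=
  W ∪ W.image fun p => (p.1, p.2.1 + 1, p.2.2)

/-- The black stones that can be removed once exactly the white stones in `W` are. -/
def maxBlacks (n : ℕ) (W : Finset (ℕ × ℕ × ℕ)) : Finset (ℕ × ℕ × ℕ) :=
  (sites n).filter fun p => p.1 = 0 ∨
    (p.2.2 = 0 ∨ (p.1 - 1, p.2.1, p.2.2 - 1) ∈ W) ∧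
      (p.2.2 = p.1 ∨ (p.1 - 1, p.2.1, p.2.2) ∈ W)

/-- The white stones that have to be removed before the black stones in `B`. -/
def minWhites (n : ℕ) (B : Finset (ℕ × ℕ × ℕ)) : Finset (ℕ × ℕ × ℕ) :=
  (sites n).filter fun p =>
    (p.1 + 1, p.2.1, p.2.2) ∈ B ∨ (p.1 + 1, p.2.1, p.2.2 + 1) ∈ B

/-- The white stones that can be removed once exactly the black stones in `B` are. -/
def maxWhites (B : Finset (ℕ × ℕ × ℕ)) : Finset (ℕ × ℕ × ℕ) :=
  B.filter fun p => (p.1, p.2.1 + 1, p.2.2) ∈ B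

theorem whitesClosed_iff_minBlacks {W B : Finset (ℕ × ℕ × ℕ)} :
    WhitesClosed W B ↔ minBlacks W ⊆ B := by
  simp only [WhitesClosed, minBlacks, union_subset_iff, image_subset_iff, forall_eq_or_imp,
    forall_eq]
  exact ⟨fun h => ⟨fun p hp => (h p hp).1, fun p hp => (h p hp).2⟩,
    fun h p hp => ⟨h.1 hp, h.2 p hp⟩⟩

theorem whitesClosed_iff_maxWhites {W B : Finset (ℕ × ℕ × ℕ)} :
    WhitesClosed W B ↔ W ⊆ maxWhites B := by
  simp only [WhitesClosed, maxWhites, subset_iff, mem_filter, forall_eq_or_imp, forall_eq]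

theorem blacksClosed_iff_maxBlacks {n : ℕ} {W B : Finset (ℕ × ℕ × ℕ)} :
    B ⊆ sites n ∧ BlacksClosed W B ↔ B ⊆ maxBlacks n W := by
  constructor
  · rintro ⟨hB, h⟩ ⟨k, i, j⟩ hp
    have hs := mem_sites.1 (hB hp)
    refine mem_filter.2 ⟨hB hp, ?_⟩
    rcases k with _ | k
    · simp
    · have h1 := h _ hp k (j - 1) rfl
      have h2 := h _ hp k j rfl
      grind
  · intro h
    refine ⟨h.trans (filter_subset _ _), ?_⟩
    rintro ⟨k', i, j⟩ hp k y rfl hy hk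
    have := (mem_filter.1 (h hp)).2
    grind

theorem blacksClosed_iff_minWhites {n : ℕ} {W B : Finset (ℕ × ℕ × ℕ)} (hB : B ⊆ sites n) :
    BlacksClosed W B ↔ minWhites n B ⊆ W := by
  constructor
  · rintro h ⟨k, i, j⟩ hp
    simp only [minWhites, mem_filter, mem_sites] at hp
    rcases hp with ⟨hs, hp | hp⟩
    · exact h _ hp k j rfl (Or.inr rfl) hs.2
    · exact h _ hp k j rfl (Or.inl rfl) hs.2
  · rintro h ⟨k', i, j⟩ hp k y rfl hy hk
    have hs := mem_sites.1 (hB hp)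
    apply h
    simp only [minWhites, mem_filter, mem_sites]
    grind

theorem minBlacks_subset_maxBlacks_iff {n : ℕ} {W : Finset (ℕ × ℕ × ℕ)} (hW : W ⊆ sites n) :
    minBlacks W ⊆ maxBlacks (n + 1) W ↔ minWhites n W ⊆ maxWhites W := by
  rw [← whitesClosed_iff_maxWhites, ← blacksClosed_iff_maxBlacks]
  constructor
  · rintro ⟨-, h⟩ ⟨k, i, j⟩ hp i' hi
    simp only [minWhites, mem_filter, mem_sites] at hp
    obtain ⟨hs, hp⟩ := hp
    have key (y : ℕ) (hy : (k + 1, i, y) ∈ W) : (k + 1, i', y) ∈ minBlacks W := by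
      rw [minBlacks, mem_union, mem_image]
      rcases hi with rfl | rfl
      · exact Or.inl hy
      · exact Or.inr ⟨_, hy, rfl⟩
    rcases hp with hp | hp
    · exact h _ (key _ hp) k j rfl (Or.inr rfl) hs.2
    · exact h _ (key _ hp) k j rfl (Or.inl rfl) hs.2
  · intro h
    constructor
    · intro p hp
      simp only [minBlacks, mem_union, mem_image] at hp
      rcases hp with hp | ⟨q, hq, rfl⟩
      · have := mem_sites.1 (hW hp)
        exact mem_sites.2 (by omega)
      · have := mem_sites.1 (hW hq)
        exact mem_sites.2 (by dsimp only; omega)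
    · rintro ⟨k', i, j⟩ hp k y rfl hy hk
      simp only [minBlacks, mem_union, mem_image] at hp
      have key (x : ℕ) (hx : (k + 1, x, j) ∈ W) : (k, x, y) ∈ minWhites n W := by
        have := mem_sites.1 (hW hx)
        simp only [minWhites, mem_filter, mem_sites]
        grind
      rcases hp with hp | ⟨⟨k', x, j'⟩, hq, hpq⟩
      · exact h _ (key _ hp) i (Or.inl rfl)
      · simp only [Prod.mk.injEq] at hpq
        obtain ⟨rfl, rfl, rfl⟩ := hpq
        exact h _ (key _ hq) _ (Or.inr rfl)

theorem card_minBlacks_add_card_maxWhites (W : Finset (ℕ × ℕ × ℕ)) :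
    (minBlacks W).card + (maxWhites W).card = 2 * W.card := by
  have hinj : Function.Injective fun p : ℕ × ℕ × ℕ => (p.1, p.2.1 + 1, p.2.2) := by
    rintro ⟨a, b, c⟩ ⟨a', b', c'⟩ h
    simpa using h
  have h : (maxWhites W).card =
      (W ∩ W.image fun p : ℕ × ℕ × ℕ => (p.1, p.2.1 + 1, p.2.2)).card := by
    rw [← card_image_of_injective (maxWhites W) hinj]
    congr 1
    ext p
    simp only [maxWhites, mem_image, mem_filter, mem_inter]
    grind
  rw [h, minBlacks, card_union_add_card_inter, card_image_of_injective _ hinj, two_mul]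

theorem card_maxBlacks_add_card_minWhites {n : ℕ} {W : Finset (ℕ × ℕ × ℕ)}
    (hW : W ⊆ sites n) :
    (maxBlacks (n + 1) W).card + (minWhites n W).card = n + 1 + 2 * W.card := by
  let u (p : ℕ × ℕ × ℕ) : ℕ × ℕ × ℕ := (p.1 + 1, p.2.1, p.2.2)
  let v (p : ℕ × ℕ × ℕ) : ℕ × ℕ × ℕ := (p.1 + 1, p.2.1, p.2.2 + 1)
  let t (p : ℕ × ℕ × ℕ) : ℕ × ℕ × ℕ := (p.1 + 2, p.2.1, p.2.2 + 1)
  let s (i : ℕ) : ℕ × ℕ × ℕ := (0, i, 0)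
  have memu (k i j : ℕ) : (k, i, j) ∈ W.image u ↔ k ≠ 0 ∧ (k - 1, i, j) ∈ W := by
    simp only [mem_image, u]
    clear * -
    grind
  have memv (k i j : ℕ) :
      (k, i, j) ∈ W.image v ↔ k ≠ 0 ∧ j ≠ 0 ∧ (k - 1, i, j - 1) ∈ W := by
    simp only [mem_image, v]
    clear * -
    grind
  have memt (k i j : ℕ) :
      (k, i, j) ∈ (minWhites n W).image t ↔
        2 ≤ k ∧ 1 ≤ j ∧ (k - 2, i, j - 1) ∈ minWhites n W := by
    simp only [mem_image, t]
    clear * -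
    grind
  have mems (k i j : ℕ) : (k, i, j) ∈ (range (n + 1)).image s ↔ k = 0 ∧ i < n + 1 ∧ j = 0 := by
    simp only [mem_image, s, mem_range]
    clear * -
    grind
  have hu : Function.Injective u := by
    rintro ⟨a, b, c⟩ ⟨a', b', c'⟩ h
    simpa [u] using h
  have hv : Function.Injective v := by
    rintro ⟨a, b, c⟩ ⟨a', b', c'⟩ h
    simpa [v] using h
  have ht : Function.Injective t := by
    rintro ⟨a, b, c⟩ ⟨a', b', c'⟩ h
    simpa [t] using h
  have hs : Function.Injective s := by
    intro a b h
    simpa [s] using h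
  have hWs (k i j : ℕ) (h : (k, i, j) ∈ W) : i + k + 1 ≤ n ∧ j ≤ k := mem_sites.1 (hW h)
  have hL : (W.image u ∪ W.image v).filter (fun p => ¬ (p.2.2 = 0 ∨ p.2.2 = p.1)) =
      (minWhites n W).image t := by
    ext ⟨k, i, j⟩
    rw [memt, mem_filter, mem_union, memu, memv]
    simp only [minWhites, mem_filter, mem_sites]
    clear * - hWs
    rcases k with _ | _ | k <;> rcases j with _ | j <;> grind
  have hU : maxBlacks (n + 1) W = (range (n + 1)).image s ∪
      (W.image u ∩ W.image v ∪
        (W.image u ∪ W.image v).filter (fun p => p.2.2 = 0 ∨ p.2.2 = p.1)) := by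
    ext ⟨k, i, j⟩
    rw [mem_union, mem_union, mem_inter, mem_filter, mem_union, memu, memv, mems]
    simp only [maxBlacks, mem_filter, mem_sites]
    clear * - hWs
    rcases k with _ | _ | k <;> rcases j with _ | j <;> grind
  have hd1 : Disjoint ((range (n + 1)).image s) (W.image u ∩ W.image v ∪
      (W.image u ∪ W.image v).filter (fun p => p.2.2 = 0 ∨ p.2.2 = p.1)) := by
    rw [disjoint_left]
    rintro ⟨k, i, j⟩
    rw [mem_union, mem_inter, mem_filter, mem_union, memu, memv, mems]
    clear * - hWs
    rcases k with _ | _ | k <;> rcases j with _ | j <;> grind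
  have hd2 : Disjoint (W.image u ∩ W.image v)
      ((W.image u ∪ W.image v).filter (fun p => p.2.2 = 0 ∨ p.2.2 = p.1)) := by
    rw [disjoint_left]
    rintro ⟨k, i, j⟩
    rw [mem_inter, mem_filter, mem_union, memu, memv]
    clear * - hWs
    rcases k with _ | _ | k <;> rcases j with _ | j <;> grind
  have h1 := card_union_add_card_inter (W.image u) (W.image v)
  have h2 := card_filter_add_card_filter_not (s := W.image u ∪ W.image v)
    (fun p => p.2.2 = 0 ∨ p.2.2 = p.1)
  rw [hL, card_image_of_injective _ ht] at h2
  rw [card_image_of_injective _ hu, card_image_of_injective _ hv] at h1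
  rw [hU, card_union_of_disjoint hd1, card_union_of_disjoint hd2,
    card_image_of_injective _ hs, card_range]
  omega

theorem sum_Icc_pow_card {α R : Type*} [DecidableEq α] [CommSemiring R] {s t : Finset α}
    (h : s ⊆ t) (b : R) :
    ∑ B ∈ Icc s t, b ^ B.card = b ^ s.card * (1 + b) ^ (t.card - s.card) := by
  have hd {u : Finset α} (hu : u ∈ (t \ s).powerset) : Disjoint s u :=
    disjoint_sdiff.mono_right (mem_powerset.1 hu)
  rw [Icc_eq_image_powerset h, sum_image fun u hu v hv huv => by
      rw [← union_sdiff_cancel_left (hd hu), ← union_sdiff_cancel_left (hd hv)]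
      exact congrArg (· \ s) huv,
    ← card_sdiff_of_subset h, ← prod_const (1 + b), prod_one_add, mul_sum]
  refine sum_congr rfl fun u hu => ?_
  rw [card_union_of_disjoint (hd hu), pow_add, prod_const]

theorem weight_succ {K : Type*} [Field K] (m : ℕ) (a : K) {b : K} (hb : b ≠ 0) :
    weight (m + 1) a b = (1 + b) ^ (m + 1) * weight m b⁻¹ (a * b ^ 2) := by
  classical
  have h1 : weight (m + 1) a b = ∑ W ∈ (sites m).powerset,
      a ^ W.card * ∑ B ∈ Icc (minBlacks W) (maxBlacks (m + 1) W), b ^ B.card := by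
    simp_rw [mul_sum]
    refine sum_finset_product (configs (m + 1)) _ _ ?_
    rintro ⟨W, B⟩
    rw [mem_configs, mem_powerset, mem_Icc, ← blacksClosed_iff_maxBlacks,
      whitesClosed_iff_minBlacks]
    simp only [Nat.add_sub_cancel]
    tauto
  have h2 : weight m b⁻¹ (a * b ^ 2) = ∑ W ∈ (sites m).powerset,
      (a * b ^ 2) ^ W.card * ∑ V ∈ Icc (minWhites m W) (maxWhites W), b⁻¹ ^ V.card := by
    simp_rw [mul_sum]
    rw [weight, ← sum_finset_product_right (configs m)
      (f := fun q => (a * b ^ 2) ^ q.2.card * b⁻¹ ^ q.1.card)]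
    · exact sum_congr rfl fun q _ => mul_comm _ _
    rintro ⟨V, W⟩
    rw [mem_configs, mem_powerset, mem_Icc, whitesClosed_iff_maxWhites]
    constructor
    · rintro ⟨⟨-, hW⟩, hV, h⟩
      exact ⟨hW, (blacksClosed_iff_minWhites hW).1 h, hV⟩
    · rintro ⟨hW, h, hV⟩
      refine ⟨⟨fun p hp => ?_, hW⟩, hV, (blacksClosed_iff_minWhites hW).2 h⟩
      have hp' := mem_sites.1 (hW (mem_filter.1 (hV hp)).2)
      dsimp only at hp'
      exact mem_sites.2 (by omega)
  rw [h1, h2, mul_sum]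
  refine sum_congr rfl fun W hW => ?_
  rw [mem_powerset] at hW
  by_cases h : minBlacks W ⊆ maxBlacks (m + 1) W
  · have h' := (minBlacks_subset_maxBlacks_iff hW).1 h
    have c1 := card_minBlacks_add_card_maxWhites W
    have c2 := card_maxBlacks_add_card_minWhites hW
    have e := card_le_card h
    have e' := card_le_card h'
    rw [sum_Icc_pow_card h, sum_Icc_pow_card h']
    obtain ⟨f, hf⟩ := Nat.exists_eq_add_of_le e'
    have hfree : (maxBlacks (m + 1) W).card - (minBlacks W).card = m + 1 + f := by omega
    have hb' : 1 + b⁻¹ = (1 + b) * b⁻¹ := by field_simp; ring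
    have hpow : b ^ (2 * W.card) * (b⁻¹ ^ (minWhites m W).card * b⁻¹ ^ f) =
        b ^ (minBlacks W).card := by
      rw [← pow_add, ← hf, ← c1, pow_add, mul_assoc, ← mul_pow, mul_inv_cancel₀ hb, one_pow,
        mul_one]
    rw [hfree, hf, Nat.add_sub_cancel_left, hb', ← hpow, mul_pow, mul_pow, ← pow_mul, pow_add]
    ring
  · have h' := mt (minBlacks_subset_maxBlacks_iff hW).2 h
    rw [Icc_eq_empty h, Icc_eq_empty h']
    simp

theorem weight_zero {R : Type*} [CommSemiring R] (a b : R) : weight 0 a b = 1 := by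
  have h : configs 0 = {(∅, ∅)} := by
    ext ⟨W, B⟩
    have hs : sites 0 = ∅ := rfl
    rw [mem_configs, mem_singleton, hs, Prod.mk.injEq]
    simp only [subset_empty]
    constructor
    · exact fun h => h.1
    · rintro ⟨rfl, rfl⟩
      simp [WhitesClosed, BlacksClosed]
  simp [weight, h]

theorem weight_eq_prod_of_ne_zero {K : Type*} [Field K] (m : ℕ) {a b : K} (ha : a ≠ 0)
    (hb : b ≠ 0) :
    weight m a b = ∏ k ∈ Icc 1 m, (1 + a ^ (m - k) * b ^ (m - k + 1)) ^ k := by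
  induction m generalizing a b with
  | zero => simp [weight_zero]
  | succ m ih =>
    rw [weight_succ m a hb, ih (inv_ne_zero hb) (by positivity), prod_Icc_succ_top (by omega),
      mul_comm]
    congr 1
    · refine prod_congr rfl fun k hk => ?_
      rw [Nat.succ_sub (mem_Icc.1 hk).2]
      congr 2
      generalize m - k = l
      rw [pow_succ (a * b ^ 2), ← mul_assoc, ← mul_pow]
      have : b⁻¹ * (a * b ^ 2) = a * b := by field_simp
      rw [this, Nat.succ_eq_add_one]
      ring
    · simp

theorem weight_X_eq_prod (m : ℕ) :
    weight m (MvPolynomial.X 0 : MvPolynomial (Fin 2) ℤ) (MvPolynomial.X 1) =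
      ∏ k ∈ Icc 1 m,
        (1 + MvPolynomial.X 0 ^ (m - k) * MvPolynomial.X 1 ^ (m - k + 1)) ^ k := by
  have hinj := IsFractionRing.injective (MvPolynomial (Fin 2) ℤ)
    (FractionRing (MvPolynomial (Fin 2) ℤ))
  apply hinj
  have hne (i : Fin 2) : algebraMap (MvPolynomial (Fin 2) ℤ)
      (FractionRing (MvPolynomial (Fin 2) ℤ)) (MvPolynomial.X i) ≠ 0 :=
    (map_ne_zero_iff _ hinj).2 (MvPolynomial.X_ne_zero i)
  rw [map_weight, weight_eq_prod_of_ne_zero m (hne 0) (hne 1)]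
  simp

end FinPyramid

open MvPowerSeries in
/-- **Nagao–Nakajima, Theorem 4.10 (first formula).**
`Z^m_fin-pyramid(p) = ∏_{m'=1}^{m} (1 + p0^{m−m'} p1^{m−m'+1})^{m'}`. -/
theorem finite_pyramid_generating_function (m : ℕ) :
    finPyramidZ m =
      ∏ m' ∈ Finset.Icc 1 m,
        (1 + (X 0 : MvPowerSeries (Fin 2) ℤ) ^ (m - m') * X 1 ^ (m - m' + 1)) ^ m' := by
  have h := congrArg MvPolynomial.coeToMvPowerSeries.ringHom (FinPyramid.weight_X_eq_prod m)
  rw [FinPyramid.map_weight] at h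
  rw [FinPyramid.finPyramidZ_eq_weight]
  simpa using h
end

section
/- Let W be a nonzero θ_ζ-stable A-module for some ζ ∈ ℝ². Then at least one of the following holds: (1) dim W0 = dim W1 = 1; (2) the linear maps a1 and a2 are both zero; (3) the linear maps b1 and b2 are both zero. -/
open Matrix

structure ARep : Type where
  d0 : ℕ
  d1 : ℕ
  a1 : Matrix (Fin d1) (Fin d0) ℂ
  a2 : Matrix (Fin d1) (Fin d0) ℂ
  b1 : Matrix (Fin d0) (Fin d1) ℂ
  b2 : Matrix (Fin d0) (Fin d1) ℂ
  rel1 : a1 * b1 * a2 = a2 * b1 * a1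
  rel2 : a1 * b2 * a2 = a2 * b2 * a1
  rel3 : b1 * a1 * b2 = b2 * a1 * b1
  rel4 : b1 * a2 * b2 = b2 * a2 * b1

structure ASub (V : ARep) : Type where
  S0 : Submodule ℂ (Fin V.d0 → ℂ)
  S1 : Submodule ℂ (Fin V.d1 → ℂ)
  ha1 : ∀ x ∈ S0, V.a1.mulVec x ∈ S1
  ha2 : ∀ x ∈ S0, V.a2.mulVec x ∈ S1
  hb1 : ∀ y ∈ S1, V.b1.mulVec y ∈ S0
  hb2 : ∀ y ∈ S1, V.b2.mulVec y ∈ S0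

def ASub.IsBot {V : ARep} (S : ASub V) : Prop := S.S0 = ⊥ ∧ S.S1 = ⊥

def ASub.IsTop {V : ARep} (S : ASub V) : Prop := S.S0 = ⊤ ∧ S.S1 = ⊤

noncomputable def ASub.dim0 {V : ARep} (S : ASub V) : ℕ := Module.finrank ℂ S.S0
noncomputable def ASub.dim1 {V : ARep} (S : ASub V) : ℕ := Module.finrank ℂ S.S1

noncomputable def theta (ζ : ℝ × ℝ) (n0 n1 : ℕ) : ℝ :=
  (ζ.1 * n0 + ζ.2 * n1) / (n0 + n1)

def IsStableA (ζ : ℝ × ℝ) (V : ARep) : Prop :=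
  ∀ S : ASub V, ¬ S.IsBot → ¬ S.IsTop →
    theta ζ S.dim0 S.dim1 < theta ζ V.d0 V.d1

theorem ASub.dim_pos {V : ARep} (S : ASub V) (h : ¬ S.IsBot) : 0 < S.dim0 + S.dim1 := by
  by_contra h0
  have h1 : S.dim0 = 0 ∧ S.dim1 = 0 := by omega
  exact h ⟨Submodule.finrank_eq_zero.mp h1.1, Submodule.finrank_eq_zero.mp h1.2⟩

theorem ASub.dim0_le {V : ARep} (S : ASub V) : S.dim0 ≤ V.d0 :=
  (Submodule.finrank_le S.S0).trans_eq (Module.finrank_fin_fun ℂ)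

theorem ASub.dim1_le {V : ARep} (S : ASub V) : S.dim1 ≤ V.d1 :=
  (Submodule.finrank_le S.S1).trans_eq (Module.finrank_fin_fun ℂ)

theorem ASub.dim0_eq_of_eq_top {V : ARep} (S : ASub V) (h : S.S0 = ⊤) : S.dim0 = V.d0 := by
  rw [ASub.dim0, h, finrank_top, Module.finrank_fin_fun]

theorem ASub.dim1_eq_of_eq_top {V : ARep} (S : ASub V) (h : S.S1 = ⊤) : S.dim1 = V.d1 := by
  rw [ASub.dim1, h, finrank_top, Module.finrank_fin_fun]

theorem Matrix.eq_zero_of_mulVecLin_eq_zero {m n : ℕ} {M : Matrix (Fin m) (Fin n) ℂ}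
    (h : M.mulVecLin = 0) : M = 0 :=
  Matrix.ext_of_mulVec_single fun i ↦
    (LinearMap.congr_fun h (Pi.single i 1)).trans (zero_mulVec _).symm

/-- Stability, with denominators cleared in the slope of the submodule. -/
theorem IsStableA.lt_mul {ζ : ℝ × ℝ} {W : ARep} (hst : IsStableA ζ W) (S : ASub W)
    (hbot : ¬ S.IsBot) (htop : ¬ S.IsTop) :
    ζ.1 * S.dim0 + ζ.2 * S.dim1 < theta ζ W.d0 W.d1 * (S.dim0 + S.dim1) := by
  have hpos : (0 : ℝ) < S.dim0 + S.dim1 := by exact_mod_cast S.dim_pos hbot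
  exact (div_lt_iff₀ hpos).mp (hst S hbot htop)

theorem theta_mul (ζ : ℝ × ℝ) {m n : ℕ} (h : 0 < m + n) :
    theta ζ m n * (m + n) = ζ.1 * m + ζ.2 * n := by
  have hpos : (0 : ℝ) < m + n := by exact_mod_cast h
  exact div_mul_cancel₀ _ hpos.ne'

/-- The kernel of an endomorphism of a representation. -/
def ASub.ker (W : ARep) (F : Matrix (Fin W.d0) (Fin W.d0) ℂ) (G : Matrix (Fin W.d1) (Fin W.d1) ℂ)
    (h1 : W.a1 * F = G * W.a1) (h2 : W.a2 * F = G * W.a2)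
    (h3 : W.b1 * G = F * W.b1) (h4 : W.b2 * G = F * W.b2) : ASub W where
  S0 := LinearMap.ker F.mulVecLin
  S1 := LinearMap.ker G.mulVecLin
  ha1 x hx := by
    simp only [LinearMap.mem_ker, mulVecLin_apply, mulVec_mulVec] at hx ⊢
    rw [← h1, ← mulVec_mulVec, hx, mulVec_zero]
  ha2 x hx := by
    simp only [LinearMap.mem_ker, mulVecLin_apply, mulVec_mulVec] at hx ⊢
    rw [← h2, ← mulVec_mulVec, hx, mulVec_zero]
  hb1 x hx := by
    simp only [LinearMap.mem_ker, mulVecLin_apply, mulVec_mulVec] at hx ⊢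
    rw [← h3, ← mulVec_mulVec, hx, mulVec_zero]
  hb2 x hx := by
    simp only [LinearMap.mem_ker, mulVecLin_apply, mulVec_mulVec] at hx ⊢
    rw [← h4, ← mulVec_mulVec, hx, mulVec_zero]

/-- The image of an endomorphism of a representation. -/
def ASub.range (W : ARep) (F : Matrix (Fin W.d0) (Fin W.d0) ℂ)
    (G : Matrix (Fin W.d1) (Fin W.d1) ℂ)
    (h1 : W.a1 * F = G * W.a1) (h2 : W.a2 * F = G * W.a2)
    (h3 : W.b1 * G = F * W.b1) (h4 : W.b2 * G = F * W.b2) : ASub W where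
  S0 := LinearMap.range F.mulVecLin
  S1 := LinearMap.range G.mulVecLin
  ha1 := by
    rintro _ ⟨x, rfl⟩
    exact ⟨W.a1 *ᵥ x, by simp only [mulVecLin_apply, mulVec_mulVec, h1]⟩
  ha2 := by
    rintro _ ⟨x, rfl⟩
    exact ⟨W.a2 *ᵥ x, by simp only [mulVecLin_apply, mulVec_mulVec, h2]⟩
  hb1 := by
    rintro _ ⟨x, rfl⟩
    exact ⟨W.b1 *ᵥ x, by simp only [mulVecLin_apply, mulVec_mulVec, h3]⟩
  hb2 := by
    rintro _ ⟨x, rfl⟩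
    exact ⟨W.b2 *ᵥ x, by simp only [mulVecLin_apply, mulVec_mulVec, h4]⟩

/-- A non-injective endomorphism of a stable representation is zero. -/
theorem IsStableA.ker_isTop {ζ : ℝ × ℝ} {W : ARep} (hst : IsStableA ζ W)
    (F : Matrix (Fin W.d0) (Fin W.d0) ℂ) (G : Matrix (Fin W.d1) (Fin W.d1) ℂ)
    (h1 : W.a1 * F = G * W.a1) (h2 : W.a2 * F = G * W.a2)
    (h3 : W.b1 * G = F * W.b1) (h4 : W.b2 * G = F * W.b2)
    (hbot : ¬ (ASub.ker W F G h1 h2 h3 h4).IsBot) : F = 0 ∧ G = 0 := by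
  by_contra hne
  have e0 : (ASub.range W F G h1 h2 h3 h4).dim0 + (ASub.ker W F G h1 h2 h3 h4).dim0 = W.d0 := by
    exact F.mulVecLin.finrank_range_add_finrank_ker.trans (Module.finrank_fin_fun ℂ)
  have e1 : (ASub.range W F G h1 h2 h3 h4).dim1 + (ASub.ker W F G h1 h2 h3 h4).dim1 = W.d1 := by
    exact G.mulVecLin.finrank_range_add_finrank_ker.trans (Module.finrank_fin_fun ℂ)
  have hKtop : ¬ (ASub.ker W F G h1 h2 h3 h4).IsTop := fun ⟨hF, hG⟩ ↦ hne
    ⟨eq_zero_of_mulVecLin_eq_zero (LinearMap.ker_eq_top.mp hF),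
      eq_zero_of_mulVecLin_eq_zero (LinearMap.ker_eq_top.mp hG)⟩
  have hIbot : ¬ (ASub.range W F G h1 h2 h3 h4).IsBot := fun ⟨hF, hG⟩ ↦ hne
    ⟨eq_zero_of_mulVecLin_eq_zero (LinearMap.range_eq_bot.mp hF),
      eq_zero_of_mulVecLin_eq_zero (LinearMap.range_eq_bot.mp hG)⟩
  have hItop : ¬ (ASub.range W F G h1 h2 h3 h4).IsTop := fun ⟨hF, hG⟩ ↦ hbot
    ⟨LinearMap.ker_eq_bot_iff_range_eq_top.mpr hF, LinearMap.ker_eq_bot_iff_range_eq_top.mpr hG⟩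
  have k := hst.lt_mul _ hbot hKtop
  have i := hst.lt_mul _ hIbot hItop
  have t := theta_mul ζ (m := W.d0) (n := W.d1) (by have := ASub.dim_pos _ hbot; omega)
  have e0' := congrArg (Nat.cast (R := ℝ)) e0
  have e1' := congrArg (Nat.cast (R := ℝ)) e1
  push_cast at e0' e1'
  generalize theta ζ W.d0 W.d1 = s at *
  rw [← e0', ← e1'] at t
  linarith

theorem Matrix.exists_sub_smul_one_ker_ne_bot {n : ℕ} (hn : 0 < n)
    (F : Matrix (Fin n) (Fin n) ℂ) : ∃ c : ℂ, LinearMap.ker (F - c • 1).mulVecLin ≠ ⊥ := by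
  have : Nonempty (Fin n) := ⟨⟨0, hn⟩⟩
  obtain ⟨c, hc⟩ := Module.End.exists_eigenvalue F.mulVecLin
  obtain ⟨v, hv⟩ := hc.exists_hasEigenvector
  refine ⟨c, (Submodule.ne_bot_iff _).mpr ⟨v, ?_, hv.2⟩⟩
  have := hv.apply_eq_smul
  simp only [mulVecLin_apply] at this
  simp [this]

/-- Schur's lemma: endomorphisms of a nonzero stable representation are scalars. -/
theorem IsStableA.schur {ζ : ℝ × ℝ} {W : ARep} (hst : IsStableA ζ W) (hW : 0 < W.d0 + W.d1)
    (F : Matrix (Fin W.d0) (Fin W.d0) ℂ) (G : Matrix (Fin W.d1) (Fin W.d1) ℂ)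
    (h1 : W.a1 * F = G * W.a1) (h2 : W.a2 * F = G * W.a2)
    (h3 : W.b1 * G = F * W.b1) (h4 : W.b2 * G = F * W.b2) :
    ∃ c : ℂ, F = c • 1 ∧ G = c • 1 := by
  obtain ⟨c, hc⟩ : ∃ c : ℂ, ¬ (LinearMap.ker (F - c • 1).mulVecLin = ⊥ ∧
      LinearMap.ker (G - c • 1).mulVecLin = ⊥) := by
    rcases Nat.eq_zero_or_pos W.d0 with h0 | h0
    · obtain ⟨c, hc⟩ := exists_sub_smul_one_ker_ne_bot (by omega) G
      exact ⟨c, fun h ↦ hc h.2⟩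
    · obtain ⟨c, hc⟩ := exists_sub_smul_one_ker_ne_bot h0 F
      exact ⟨c, fun h ↦ hc h.1⟩
  have := hst.ker_isTop (F - c • 1) (G - c • 1) (by simp [Matrix.mul_sub, Matrix.sub_mul, h1])
    (by simp [Matrix.mul_sub, Matrix.sub_mul, h2]) (by simp [Matrix.mul_sub, Matrix.sub_mul, h3])
    (by simp [Matrix.mul_sub, Matrix.sub_mul, h4]) hc
  exact ⟨c, sub_eq_zero.mp this.1, sub_eq_zero.mp this.2⟩

theorem Matrix.mulVec_mem_span_of_mul_eq_smul_one {m n : ℕ} {a a' : Matrix (Fin m) (Fin n) ℂ}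
    {b : Matrix (Fin n) (Fin m) ℂ} {c c' : ℂ} (hc : c ≠ 0) (hab : a * b = c • 1)
    (hba' : b * a' = c' • 1) (v : Fin n → ℂ) : a' *ᵥ v ∈ Submodule.span ℂ {a *ᵥ v} := by
  have h : c • a' = c' • a := by
    calc c • a' = (a * b) * a' := by simp [hab]
      _ = c' • a := by rw [Matrix.mul_assoc, hba']; simp
  have h' : c • (a' *ᵥ v) = c' • (a *ᵥ v) := by rw [← smul_mulVec, h, smul_mulVec]
  refine Submodule.mem_span_singleton.mpr ⟨c⁻¹ * c', ?_⟩
  rw [mul_smul, ← h', inv_smul_smul₀ hc]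

/-- If some loop acts by a nonzero scalar on a stable representation, then the representation
has dimension vector `(1, 1)`. -/
theorem IsStableA.dim_eq_one {ζ : ℝ × ℝ} {W : ARep} (hst : IsStableA ζ W) (hW : 0 < W.d0 + W.d1)
    {a : Matrix (Fin W.d1) (Fin W.d0) ℂ} {b : Matrix (Fin W.d0) (Fin W.d1) ℂ} {c : ℂ}
    (hc : c ≠ 0) (hba : b * a = c • 1) (hab : a * b = c • 1)
    (ha1 : ∃ k : ℂ, b * W.a1 = k • 1) (ha2 : ∃ k : ℂ, b * W.a2 = k • 1)
    (hb1 : ∃ k : ℂ, W.b1 * a = k • 1) (hb2 : ∃ k : ℂ, W.b2 * a = k • 1) :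
    W.d0 = 1 ∧ W.d1 = 1 := by
  have hd : W.d0 = W.d1 := by
    have hl : (c⁻¹ • b) * a = 1 := by simp [hba, hc]
    have hr : a * (c⁻¹ • b) = 1 := by simp [hab, hc]
    simpa using Matrix.square_of_invertible (c⁻¹ • b) a hl hr
  by_contra hne
  have hd2 : 2 ≤ W.d0 := by omega
  set v : Fin W.d0 → ℂ := Pi.single ⟨0, by omega⟩ 1 with hv
  have hv0 : v ≠ 0 := by simp [hv]
  have hav0 : a *ᵥ v ≠ 0 := by
    intro h
    have : b *ᵥ (a *ᵥ v) = c • v := by rw [mulVec_mulVec, hba, smul_mulVec, one_mulVec]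
    rw [h, mulVec_zero] at this
    exact (smul_ne_zero hc hv0) this.symm
  have hback : ∀ b' : Matrix (Fin W.d0) (Fin W.d1) ℂ, (∃ k : ℂ, b' * a = k • 1) →
      ∀ y ∈ Submodule.span ℂ {a *ᵥ v}, b' *ᵥ y ∈ Submodule.span ℂ {v} := by
    rintro b' ⟨k, hk⟩ y hy
    obtain ⟨r, rfl⟩ := Submodule.mem_span_singleton.mp hy
    rw [mulVec_smul, mulVec_mulVec, hk, smul_mulVec, one_mulVec]
    exact Submodule.smul_mem _ _ (Submodule.smul_mem _ _ (Submodule.mem_span_singleton_self v))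
  have hforth : ∀ a' : Matrix (Fin W.d1) (Fin W.d0) ℂ, (∃ k : ℂ, b * a' = k • 1) →
      ∀ x ∈ Submodule.span ℂ {v}, a' *ᵥ x ∈ Submodule.span ℂ {a *ᵥ v} := by
    rintro a' ⟨k, hk⟩ x hx
    obtain ⟨r, rfl⟩ := Submodule.mem_span_singleton.mp hx
    rw [mulVec_smul]
    exact Submodule.smul_mem _ _ (mulVec_mem_span_of_mul_eq_smul_one hc hab hk v)
  let S : ASub W :=
    { S0 := Submodule.span ℂ {v}
      S1 := Submodule.span ℂ {a *ᵥ v}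
      ha1 := hforth _ ha1
      ha2 := hforth _ ha2
      hb1 := hback _ hb1
      hb2 := hback _ hb2 }
  have s0 : S.dim0 = 1 := finrank_span_singleton hv0
  have s1 : S.dim1 = 1 := finrank_span_singleton hav0
  have hbot : ¬ S.IsBot := fun h ↦ hv0 (Submodule.span_singleton_eq_bot.mp h.1)
  have htop : ¬ S.IsTop := by
    intro h
    have : S.dim0 = W.d0 := S.dim0_eq_of_eq_top h.1
    omega
  have h := hst.lt_mul S hbot htop
  have t := theta_mul ζ hW
  rw [s0, s1] at h
  rw [← hd] at h t
  have hpos : (0 : ℝ) < W.d0 := by exact_mod_cast (by omega : 0 < W.d0)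
  push_cast at h
  nlinarith

/-- If all loops act by zero on a stable representation, then it is supported on arrows of one
direction. -/
theorem IsStableA.eq_zero_or_eq_zero {ζ : ℝ × ℝ} {W : ARep} (hst : IsStableA ζ W)
    (hW : 0 < W.d0 + W.d1)
    (h11 : W.b1 * W.a1 = 0 ∧ W.a1 * W.b1 = 0) (h12 : W.b1 * W.a2 = 0 ∧ W.a2 * W.b1 = 0)
    (h21 : W.b2 * W.a1 = 0 ∧ W.a1 * W.b2 = 0) (h22 : W.b2 * W.a2 = 0 ∧ W.a2 * W.b2 = 0) :
    (W.a1 = 0 ∧ W.a2 = 0) ∨ (W.b1 = 0 ∧ W.b2 = 0) := by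
  by_contra! hne
  obtain ⟨hna, hnb⟩ := hne
  let S : ASub W :=
    { S0 := ⊥
      S1 := LinearMap.range W.a1.mulVecLin ⊔ LinearMap.range W.a2.mulVecLin
      ha1 := by simp
      ha2 := by simp
      hb1 := by
        intro y hy
        obtain ⟨_, ⟨p, rfl⟩, _, ⟨q, rfl⟩, rfl⟩ := Submodule.mem_sup.mp hy
        simp [mulVec_add, h11, h12]
      hb2 := by
        intro y hy
        obtain ⟨_, ⟨p, rfl⟩, _, ⟨q, rfl⟩, rfl⟩ := Submodule.mem_sup.mp hy
        simp [mulVec_add, h21, h22] }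
  let T : ASub W :=
    { S0 := LinearMap.range W.b1.mulVecLin ⊔ LinearMap.range W.b2.mulVecLin
      S1 := ⊥
      ha1 := by
        intro y hy
        obtain ⟨_, ⟨p, rfl⟩, _, ⟨q, rfl⟩, rfl⟩ := Submodule.mem_sup.mp hy
        simp [mulVec_add, h11, h21]
      ha2 := by
        intro y hy
        obtain ⟨_, ⟨p, rfl⟩, _, ⟨q, rfl⟩, rfl⟩ := Submodule.mem_sup.mp hy
        simp [mulVec_add, h12, h22]
      hb1 := by simp
      hb2 := by simp }
  have hSbot : ¬ S.IsBot := by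
    rintro ⟨-, h⟩
    obtain ⟨h1, h2⟩ := sup_eq_bot_iff.mp h
    exact hna (eq_zero_of_mulVecLin_eq_zero (LinearMap.range_eq_bot.mp h1))
      (eq_zero_of_mulVecLin_eq_zero (LinearMap.range_eq_bot.mp h2))
  have hTbot : ¬ T.IsBot := by
    rintro ⟨h, -⟩
    obtain ⟨h1, h2⟩ := sup_eq_bot_iff.mp h
    exact hnb (eq_zero_of_mulVecLin_eq_zero (LinearMap.range_eq_bot.mp h1))
      (eq_zero_of_mulVecLin_eq_zero (LinearMap.range_eq_bot.mp h2))
  have s0 : S.dim0 = 0 := finrank_bot ℂ _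
  have t1 : T.dim1 = 0 := finrank_bot ℂ _
  have hs := S.dim_pos hSbot
  have ht := T.dim_pos hTbot
  have sle : S.dim1 ≤ W.d1 := S.dim1_le
  have tle : T.dim0 ≤ W.d0 := T.dim0_le
  have hStop : ¬ S.IsTop := by
    rintro ⟨h, -⟩
    have : S.dim0 = W.d0 := S.dim0_eq_of_eq_top h
    omega
  have hTtop : ¬ T.IsTop := by
    rintro ⟨-, h⟩
    have : T.dim1 = W.d1 := T.dim1_eq_of_eq_top h
    omega
  have i := hst.lt_mul S hSbot hStop
  have j := hst.lt_mul T hTbot hTtop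
  have t := theta_mul ζ hW
  have p1 : (0 : ℝ) < S.dim1 := by exact_mod_cast (by omega : 0 < S.dim1)
  have p0 : (0 : ℝ) < T.dim0 := by exact_mod_cast (by omega : 0 < T.dim0)
  have q1 : (0 : ℝ) < W.d1 := by exact_mod_cast (by omega : 0 < W.d1)
  have q0 : (0 : ℝ) < W.d0 := by exact_mod_cast (by omega : 0 < W.d0)
  rw [s0, Nat.cast_zero, mul_zero, zero_add, zero_add] at i
  rw [t1, Nat.cast_zero, mul_zero, add_zero, add_zero] at j
  have i' := mul_lt_mul_of_pos_right (lt_of_mul_lt_mul_right i p1.le) q1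
  have j' := mul_lt_mul_of_pos_right (lt_of_mul_lt_mul_right j p0.le) q0
  linarith

/-- **Lemma 3.2 of Nagao–Nakajima.**  A nonzero `θ_ζ`-stable module `W` over
the conifold quiver algebra satisfies at least one of:
(1) `dim W0 = dim W1 = 1`; (2) `a1 = a2 = 0`; (3) `b1 = b2 = 0`. -/
theorem stable_module_trichotomy (ζ : ℝ × ℝ) (W : ARep)
    (hW : 0 < W.d0 + W.d1) (hst : IsStableA ζ W) :
    (W.d0 = 1 ∧ W.d1 = 1) ∨ (W.a1 = 0 ∧ W.a2 = 0) ∨ (W.b1 = 0 ∧ W.b2 = 0) := by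
  have r1 := W.rel1
  have r2 := W.rel2
  have r3 := W.rel3
  have r4 := W.rel4
  simp only [Matrix.mul_assoc] at r1 r2 r3 r4
  obtain ⟨c11, f11, g11⟩ := hst.schur hW (W.b1 * W.a1) (W.a1 * W.b1)
    (by simp only [Matrix.mul_assoc]) (by simp only [Matrix.mul_assoc, r1])
    (by simp only [Matrix.mul_assoc]) (by simp only [Matrix.mul_assoc, r3])
  obtain ⟨c12, f12, g12⟩ := hst.schur hW (W.b1 * W.a2) (W.a2 * W.b1)
    (by simp only [Matrix.mul_assoc, r1]) (by simp only [Matrix.mul_assoc])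
    (by simp only [Matrix.mul_assoc]) (by simp only [Matrix.mul_assoc, r4])
  obtain ⟨c21, f21, g21⟩ := hst.schur hW (W.b2 * W.a1) (W.a1 * W.b2)
    (by simp only [Matrix.mul_assoc]) (by simp only [Matrix.mul_assoc, r2])
    (by simp only [Matrix.mul_assoc, r3]) (by simp only [Matrix.mul_assoc])
  obtain ⟨c22, f22, g22⟩ := hst.schur hW (W.b2 * W.a2) (W.a2 * W.b2)
    (by simp only [Matrix.mul_assoc, r2]) (by simp only [Matrix.mul_assoc])
    (by simp only [Matrix.mul_assoc, r4]) (by simp only [Matrix.mul_assoc])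
  by_cases h11 : c11 = 0
  swap
  · exact .inl (hst.dim_eq_one hW h11 f11 g11 ⟨_, f11⟩ ⟨_, f12⟩ ⟨_, f11⟩ ⟨_, f21⟩)
  by_cases h12 : c12 = 0
  swap
  · exact .inl (hst.dim_eq_one hW h12 f12 g12 ⟨_, f11⟩ ⟨_, f12⟩ ⟨_, f12⟩ ⟨_, f22⟩)
  by_cases h21 : c21 = 0
  swap
  · exact .inl (hst.dim_eq_one hW h21 f21 g21 ⟨_, f21⟩ ⟨_, f22⟩ ⟨_, f11⟩ ⟨_, f21⟩)
  by_cases h22 : c22 = 0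
  swap
  · exact .inl (hst.dim_eq_one hW h22 f22 g22 ⟨_, f21⟩ ⟨_, f22⟩ ⟨_, f12⟩ ⟨_, f22⟩)
  subst h11 h12 h21 h22
  simp only [zero_smul] at f11 g11 f12 g12 f21 g21 f22 g22
  exact .inr (hst.eq_zero_or_eq_zero hW ⟨f11, g11⟩ ⟨f12, g12⟩ ⟨f21, g21⟩ ⟨f22, g22⟩)
end

section
/- Let ζ = (ζ0, ζ1) be a stability parameter. (1) If ζ0 < ζ1, the θ_ζ-stable A-modules are exactly: the modules C^-_+(m) for m ≥ 1 (the unique stable module with a1 = a2 = 0 and dimension vector (m, m−1)), the stable modules with dimension vector (1,1), which are parameterized by the resolution Y of the conifold, and the modules C^-_-(m) for m ≥ 0 (the unique stable module with a1 = a2 = 0 and dimension vector (m, m+1)). (2) If ζ0 > ζ1, the θ_ζ-stable A-modules are exactly: C^+_+(m) for m ≥ 1 (unique stable, b1 = b2 = 0, dimension vector (m, m−1)), the stable modules with dimension vector (1,1), parameterized by the flop Y^+, and C^+_-(m) for m ≥ 0 (unique stable, b1 = b2 = 0, dimension vector (m, m+1)). -/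
open Matrix

def AEquiv (V W : ARep) : Prop :=
  ∃ (g0 : (Fin V.d0 → ℂ) ≃ₗ[ℂ] (Fin W.d0 → ℂ))
    (g1 : (Fin V.d1 → ℂ) ≃ₗ[ℂ] (Fin W.d1 → ℂ)),
    (∀ x, g1 (V.a1.mulVec x) = W.a1.mulVec (g0 x)) ∧
    (∀ x, g1 (V.a2.mulVec x) = W.a2.mulVec (g0 x)) ∧
    (∀ y, g0 (V.b1.mulVec y) = W.b1.mulVec (g1 y)) ∧
    (∀ y, g0 (V.b2.mulVec y) = W.b2.mulVec (g1 y))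

/-- The resolved conifold `Y = Tot(O_{ℙ¹}(−1) ⊕ O_{ℙ¹}(−1))`, realized as
the set of triples `(ℓ, p, q)` of a line `ℓ ⊂ ℂ²` and two points of `ℓ`.
The flop `Y⁺` is abstractly the same variety. -/
def ResolvedConifold : Type :=
  {x : Submodule ℂ (Fin 2 → ℂ) × (Fin 2 → ℂ) × (Fin 2 → ℂ) //
    Module.finrank ℂ x.1 = 1 ∧ x.2.1 ∈ x.1 ∧ x.2.2 ∈ x.1}

/-- Isomorphism classes of `θ_ζ`-stable `A`-modules with dimension
vector `(1,1)`. -/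
def StableOneOne (ζ : ℝ × ℝ) : Type :=
  Quot (fun V W : {V : ARep // IsStableA ζ V ∧ V.d0 = 1 ∧ V.d1 = 1} =>
    AEquiv V.1 W.1)

/-- Stability with respect to any `ζ` with `ζ0 < ζ1`, with the denominators cleared. -/
def ARep.SlopeStable (V : ARep) : Prop :=
  ∀ S : ASub V, ¬ S.IsBot → ¬ S.IsTop → S.dim1 * V.d0 < S.dim0 * V.d1

theorem ASub.isBot_iff {V : ARep} (S : ASub V) : S.IsBot ↔ S.dim0 + S.dim1 = 0 := by
  simp [ASub.IsBot, ASub.dim0, ASub.dim1, Submodule.finrank_eq_zero]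

theorem ASub.isTop_iff {V : ARep} (S : ASub V) :
    S.IsTop ↔ S.dim0 = V.d0 ∧ S.dim1 = V.d1 := by
  constructor
  · rintro ⟨h0, h1⟩
    rw [ASub.dim0, ASub.dim1, h0, h1]
    simp
  · rintro ⟨h0, h1⟩
    exact ⟨Submodule.eq_top_of_finrank_eq (by simpa [ASub.dim0] using h0),
      Submodule.eq_top_of_finrank_eq (by simpa [ASub.dim1] using h1)⟩

theorem theta_lt_theta_iff {ζ : ℝ × ℝ} (h : ζ.1 < ζ.2) {n0 n1 d0 d1 : ℕ}
    (hn : 0 < n0 + n1) (hd : 0 < d0 + d1) :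
    theta ζ n0 n1 < theta ζ d0 d1 ↔ n1 * d0 < n0 * d1 := by
  have hn' : (0 : ℝ) < n0 + n1 := by exact_mod_cast hn
  have hd' : (0 : ℝ) < d0 + d1 := by exact_mod_cast hd
  have key : (n1 * d0 < n0 * d1) ↔ ((n1 : ℝ) * d0 < n0 * d1) := by norm_cast
  rw [theta, theta, div_lt_div_iff₀ hn' hd', key, ← sub_pos, ← sub_pos (a := (n0 : ℝ) * d1)]
  have : (ζ.1 * d0 + ζ.2 * d1) * ((n0 : ℝ) + n1) - (ζ.1 * n0 + ζ.2 * n1) * (d0 + d1)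
      = (ζ.2 - ζ.1) * (n0 * d1 - n1 * d0) := by ring
  rw [this, mul_pos_iff_of_pos_left (sub_pos.2 h)]

theorem isStableA_iff_slopeStable {ζ : ℝ × ℝ} (h : ζ.1 < ζ.2) (V : ARep) :
    IsStableA ζ V ↔ V.SlopeStable := by
  refine forall_congr' fun S => imp_congr_right fun hb => imp_congr_right fun _ => ?_
  rw [S.isBot_iff] at hb
  have := S.dim0_le
  have := S.dim1_le
  exact theta_lt_theta_iff h (by omega) (by omega)

/-- A pair of linear maps is a homomorphism of `A`-modules. -/
structure ARep.IsHom (V W : ARep) (f0 : (Fin V.d0 → ℂ) →ₗ[ℂ] (Fin W.d0 → ℂ))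
    (f1 : (Fin V.d1 → ℂ) →ₗ[ℂ] (Fin W.d1 → ℂ)) : Prop where
  a1 : ∀ x, f1 (V.a1 *ᵥ x) = W.a1 *ᵥ f0 x
  a2 : ∀ x, f1 (V.a2 *ᵥ x) = W.a2 *ᵥ f0 x
  b1 : ∀ y, f0 (V.b1 *ᵥ y) = W.b1 *ᵥ f1 y
  b2 : ∀ y, f0 (V.b2 *ᵥ y) = W.b2 *ᵥ f1 y

namespace ARep.IsHom

variable {V W : ARep} {f0 : (Fin V.d0 → ℂ) →ₗ[ℂ] (Fin W.d0 → ℂ)}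
  {f1 : (Fin V.d1 → ℂ) →ₗ[ℂ] (Fin W.d1 → ℂ)}

/-- The kernel of a homomorphism. -/
def ker (h : V.IsHom W f0 f1) : ASub V where
  S0 := LinearMap.ker f0
  S1 := LinearMap.ker f1
  ha1 x hx := by rw [LinearMap.mem_ker] at *; rw [h.a1, hx, Matrix.mulVec_zero]
  ha2 x hx := by rw [LinearMap.mem_ker] at *; rw [h.a2, hx, Matrix.mulVec_zero]
  hb1 x hx := by rw [LinearMap.mem_ker] at *; rw [h.b1, hx, Matrix.mulVec_zero]
  hb2 x hx := by rw [LinearMap.mem_ker] at *; rw [h.b2, hx, Matrix.mulVec_zero]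

/-- The image of a homomorphism. -/
def range (h : V.IsHom W f0 f1) : ASub W where
  S0 := LinearMap.range f0
  S1 := LinearMap.range f1
  ha1 := by rintro _ ⟨x, rfl⟩; exact ⟨_, h.a1 x⟩
  ha2 := by rintro _ ⟨x, rfl⟩; exact ⟨_, h.a2 x⟩
  hb1 := by rintro _ ⟨x, rfl⟩; exact ⟨_, h.b1 x⟩
  hb2 := by rintro _ ⟨x, rfl⟩; exact ⟨_, h.b2 x⟩

/-- A nonzero homomorphism between stable modules of the same dimension vector is injective. -/
theorem injective (h : V.IsHom W f0 f1) (hV : V.SlopeStable) (hW : W.SlopeStable)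
    (e0 : V.d0 = W.d0) (e1 : V.d1 = W.d1) (hf : ¬ (f0 = 0 ∧ f1 = 0)) :
    Function.Injective f0 ∧ Function.Injective f1 := by
  have r0 : h.range.dim0 + h.ker.dim0 = V.d0 :=
    (LinearMap.finrank_range_add_finrank_ker f0).trans (by simp)
  have r1 : h.range.dim1 + h.ker.dim1 = V.d1 :=
    (LinearMap.finrank_range_add_finrank_ker f1).trans (by simp)
  have hI : ¬ h.range.IsBot := fun hb =>
    hf ⟨LinearMap.range_eq_bot.1 hb.1, LinearMap.range_eq_bot.1 hb.2⟩
  have hK : h.ker.IsBot := by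
    by_contra hb
    have h1 := hV h.ker hb (by
      rw [ASub.isTop_iff]; rw [ASub.isBot_iff] at hI; omega)
    have h2 := hW h.range hI (by
      rw [ASub.isTop_iff]; rw [ASub.isBot_iff] at hb; omega)
    rw [← e0, ← e1] at h2
    rw [← r0, ← r1] at h1 h2
    nlinarith
  exact ⟨LinearMap.ker_eq_bot.1 hK.1, LinearMap.ker_eq_bot.1 hK.2⟩

theorem aEquiv (h : V.IsHom W f0 f1) (hV : V.SlopeStable) (hW : W.SlopeStable)
    (e0 : V.d0 = W.d0) (e1 : V.d1 = W.d1) (hf : ¬ (f0 = 0 ∧ f1 = 0)) : AEquiv V W := by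
  obtain ⟨i0, i1⟩ := h.injective hV hW e0 e1 hf
  exact ⟨f0.linearEquivOfInjective i0 (by simpa using e0),
    f1.linearEquivOfInjective i1 (by simpa using e1), h.a1, h.a2, h.b1, h.b2⟩

theorem sub_smul_id {f0 : (Fin V.d0 → ℂ) →ₗ[ℂ] (Fin V.d0 → ℂ)}
    {f1 : (Fin V.d1 → ℂ) →ₗ[ℂ] (Fin V.d1 → ℂ)} (h : V.IsHom V f0 f1) (c : ℂ) :
    V.IsHom V (f0 - c • LinearMap.id) (f1 - c • LinearMap.id) where
  a1 x := by simp [h.a1, Matrix.mulVec_sub, Matrix.mulVec_smul]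
  a2 x := by simp [h.a2, Matrix.mulVec_sub, Matrix.mulVec_smul]
  b1 x := by simp [h.b1, Matrix.mulVec_sub, Matrix.mulVec_smul]
  b2 x := by simp [h.b2, Matrix.mulVec_sub, Matrix.mulVec_smul]

/-- Schur's lemma. -/
theorem exists_eq_smul_id {f0 : (Fin V.d0 → ℂ) →ₗ[ℂ] (Fin V.d0 → ℂ)}
    {f1 : (Fin V.d1 → ℂ) →ₗ[ℂ] (Fin V.d1 → ℂ)} (h : V.IsHom V f0 f1)
    (hV : V.SlopeStable) (hd : 0 < V.d0 + V.d1) :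
    ∃ c : ℂ, f0 = c • LinearMap.id ∧ f1 = c • LinearMap.id := by
  have key : ∀ c : ℂ, (∃ x, x ≠ 0 ∧ f0 x = c • x) ∨ (∃ x, x ≠ 0 ∧ f1 x = c • x) →
      f0 = c • LinearMap.id ∧ f1 = c • LinearMap.id := by
    intro c hc
    by_contra hne
    obtain ⟨i0, i1⟩ := (h.sub_smul_id c).injective hV hV rfl rfl (by
      simpa only [sub_eq_zero] using hne)
    rcases hc with ⟨x, hx, he⟩ | ⟨x, hx, he⟩
    · exact hx (i0 (by simp [he]))
    · exact hx (i1 (by simp [he]))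
  rcases Nat.eq_zero_or_pos V.d0 with h0 | h0
  · have : NeZero V.d1 := ⟨by omega⟩
    obtain ⟨c, hc⟩ := Module.End.exists_eigenvalue f1
    obtain ⟨x, hx⟩ := hc.exists_hasEigenvector
    exact ⟨c, key c (.inr ⟨x, hx.2, hx.apply_eq_smul⟩)⟩
  · have : NeZero V.d0 := ⟨by omega⟩
    obtain ⟨c, hc⟩ := Module.End.exists_eigenvalue f0
    obtain ⟨x, hx⟩ := hc.exists_hasEigenvector
    exact ⟨c, key c (.inl ⟨x, hx.2, hx.apply_eq_smul⟩)⟩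

end ARep.IsHom

namespace ARep

/-- The elements `a * b + b * a` of the path algebra are central. -/
theorem isHom_mulVecLin (V : ARep) {a : Matrix (Fin V.d1) (Fin V.d0) ℂ}
    {b : Matrix (Fin V.d0) (Fin V.d1) ℂ} (ha : a = V.a1 ∨ a = V.a2)
    (hb : b = V.b1 ∨ b = V.b2) :
    V.IsHom V (b * a).mulVecLin (a * b).mulVecLin := by
  have h1 := V.rel1
  have h2 := V.rel2
  have h3 := V.rel3
  have h4 := V.rel4
  rcases ha with rfl | rfl <;> rcases hb with rfl | rfl <;> constructor <;> intro x <;>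
    simp only [Matrix.mulVecLin_apply, Matrix.mulVec_mulVec, ← Matrix.mul_assoc, *]

theorem exists_central_eq_smul (V : ARep) (hV : V.SlopeStable) (hd : 0 < V.d0 + V.d1)
    {a : Matrix (Fin V.d1) (Fin V.d0) ℂ} {b : Matrix (Fin V.d0) (Fin V.d1) ℂ}
    (ha : a = V.a1 ∨ a = V.a2) (hb : b = V.b1 ∨ b = V.b2) :
    ∃ c : ℂ, b * a = c • (1 : Matrix _ _ ℂ) ∧ a * b = c • (1 : Matrix _ _ ℂ) := by
  obtain ⟨c, h0, h1⟩ := (V.isHom_mulVecLin ha hb).exists_eq_smul_id hV hd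
  refine ⟨c, ?_, ?_⟩
  · apply Matrix.mulVec_injective
    funext x
    simpa [Matrix.smul_mulVec] using LinearMap.congr_fun h0 x
  · apply Matrix.mulVec_injective
    funext x
    simpa [Matrix.smul_mulVec] using LinearMap.congr_fun h1 x

/-- If some central element `a * b + b * a` acts by a nonzero scalar, then the dimension
vector is `(1, 1)`. -/
theorem dim_eq_one_of_central_ne_zero (V : ARep) (hV : V.SlopeStable) (hd : 0 < V.d0 + V.d1)
    {a : Matrix (Fin V.d1) (Fin V.d0) ℂ} {b : Matrix (Fin V.d0) (Fin V.d1) ℂ}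
    (ha : a = V.a1 ∨ a = V.a2) (hb : b = V.b1 ∨ b = V.b2) {c : ℂ} (hc : c ≠ 0)
    (hba : b * a = c • (1 : Matrix _ _ ℂ)) (hab : a * b = c • (1 : Matrix _ _ ℂ)) :
    V.d0 = 1 ∧ V.d1 = 1 := by
  have hba' : ∀ x, b *ᵥ (a *ᵥ x) = c • x := fun x => by
    rw [Matrix.mulVec_mulVec, hba, Matrix.smul_mulVec, Matrix.one_mulVec]
  have hab' : ∀ x, a *ᵥ (b *ᵥ x) = c • x := fun x => by
    rw [Matrix.mulVec_mulVec, hab, Matrix.smul_mulVec, Matrix.one_mulVec]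
  have ia : Function.Injective a.mulVecLin := by
    intro x y hxy
    have := congrArg (b *ᵥ ·) hxy
    simpa [hba', hc] using this
  have ib : Function.Injective b.mulVecLin := by
    intro x y hxy
    have := congrArg (a *ᵥ ·) hxy
    simpa [hab', hc] using this
  have le1 := LinearMap.finrank_le_finrank_of_injective ia
  have le2 := LinearMap.finrank_le_finrank_of_injective ib
  simp only [Module.finrank_fin_fun] at le1 le2
  have hA : ∀ a' : Matrix (Fin V.d1) (Fin V.d0) ℂ, a' = V.a1 ∨ a' = V.a2 →
      ∃ t : ℂ, ∀ x, a' *ᵥ x = t • (a *ᵥ x) := by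
    intro a' ha'
    obtain ⟨t, -, ht⟩ := V.exists_central_eq_smul hV hd ha' hb
    refine ⟨c⁻¹ * t, fun x => ?_⟩
    have : a' *ᵥ (b *ᵥ (a *ᵥ x)) = t • (a *ᵥ x) := by
      rw [Matrix.mulVec_mulVec, ht, Matrix.smul_mulVec, Matrix.one_mulVec]
    rw [hba', Matrix.mulVec_smul] at this
    rw [mul_smul, ← this, inv_smul_smul₀ hc]
  have hB : ∀ b' : Matrix (Fin V.d0) (Fin V.d1) ℂ, b' = V.b1 ∨ b' = V.b2 →
      ∃ t : ℂ, ∀ x, b' *ᵥ (a *ᵥ x) = t • x := by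
    intro b' hb'
    obtain ⟨t, ht, -⟩ := V.exists_central_eq_smul hV hd ha hb'
    exact ⟨t, fun x => by
      rw [Matrix.mulVec_mulVec, ht, Matrix.smul_mulVec, Matrix.one_mulVec]⟩
  have : NeZero V.d0 := ⟨by omega⟩
  obtain ⟨v, hv⟩ := exists_ne (0 : Fin V.d0 → ℂ)
  have hav : a *ᵥ v ≠ 0 := fun h0 => hv (ia (by simpa using h0))
  have cA : ∀ a' : Matrix (Fin V.d1) (Fin V.d0) ℂ, a' = V.a1 ∨ a' = V.a2 →
      ∀ x ∈ Submodule.span ℂ {v}, a' *ᵥ x ∈ Submodule.span ℂ {a *ᵥ v} := by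
    intro a' ha' x hx
    obtain ⟨s, rfl⟩ := Submodule.mem_span_singleton.1 hx
    obtain ⟨t, ht⟩ := hA a' ha'
    exact Submodule.mem_span_singleton.2 ⟨s * t, by rw [Matrix.mulVec_smul, ht, mul_smul]⟩
  have cB : ∀ b' : Matrix (Fin V.d0) (Fin V.d1) ℂ, b' = V.b1 ∨ b' = V.b2 →
      ∀ x ∈ Submodule.span ℂ {a *ᵥ v}, b' *ᵥ x ∈ Submodule.span ℂ {v} := by
    intro b' hb' x hx
    obtain ⟨s, rfl⟩ := Submodule.mem_span_singleton.1 hx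
    obtain ⟨t, ht⟩ := hB b' hb'
    exact Submodule.mem_span_singleton.2 ⟨s * t, by rw [Matrix.mulVec_smul, ht, mul_smul]⟩
  let S : ASub V := ⟨Submodule.span ℂ {v}, Submodule.span ℂ {a *ᵥ v}, cA _ (.inl rfl),
    cA _ (.inr rfl), cB _ (.inl rfl), cB _ (.inr rfl)⟩
  have s0 : S.dim0 = 1 := finrank_span_singleton hv
  have s1 : S.dim1 = 1 := finrank_span_singleton hav
  by_contra hne
  have := hV S (by rw [S.isBot_iff]; omega) (by rw [S.isTop_iff]; omega)
  rw [s0, s1] at this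
  omega

theorem a_eq_zero_of_central_eq_zero (V : ARep) (hV : V.SlopeStable)
    (h11 : V.b1 * V.a1 = 0) (h12 : V.b1 * V.a2 = 0) (h21 : V.b2 * V.a1 = 0)
    (h22 : V.b2 * V.a2 = 0) : V.a1 = 0 ∧ V.a2 = 0 := by
  have hB : ∀ b : Matrix (Fin V.d0) (Fin V.d1) ℂ, b * V.a1 = 0 → b * V.a2 = 0 →
      ∀ y ∈ LinearMap.range V.a1.mulVecLin ⊔ LinearMap.range V.a2.mulVecLin,
        b *ᵥ y ∈ (⊥ : Submodule ℂ (Fin V.d0 → ℂ)) := by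
    intro b h1 h2 y hy
    obtain ⟨_, ⟨x, rfl⟩, _, ⟨x', rfl⟩, rfl⟩ := Submodule.mem_sup.1 hy
    simp [Matrix.mulVec_add, h1, h2]
  let S : ASub V := ⟨⊥, LinearMap.range V.a1.mulVecLin ⊔ LinearMap.range V.a2.mulVecLin,
    fun x hx => by simp_all, fun x hx => by simp_all, hB _ h11 h12, hB _ h21 h22⟩
  have s0 : S.dim0 = 0 := finrank_bot ℂ _
  by_cases hb : S.IsBot
  · have h := sup_eq_bot_iff.1 hb.2
    refine ⟨?_, ?_⟩ <;> apply Matrix.mulVec_injective <;> funext x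
    · simpa using LinearMap.congr_fun (LinearMap.range_eq_bot.1 h.1) x
    · simpa using LinearMap.congr_fun (LinearMap.range_eq_bot.1 h.2) x
  by_cases ht : S.IsTop
  · rw [S.isTop_iff, s0] at ht
    have : IsEmpty (Fin V.d0) := by rw [← ht.1]; infer_instance
    exact ⟨Subsingleton.elim _ _, Subsingleton.elim _ _⟩
  · have := hV S hb ht
    rw [s0] at this
    omega

/-- The map whose kernel consists of the homomorphisms `V → W` when the `a`-arrows vanish. -/
def homMap (V W : ARep) :
    (Matrix (Fin W.d0) (Fin V.d0) ℂ × Matrix (Fin W.d1) (Fin V.d1) ℂ) →ₗ[ℂ]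
      (Matrix (Fin W.d0) (Fin V.d1) ℂ × Matrix (Fin W.d0) (Fin V.d1) ℂ) where
  toFun g := (g.1 * V.b1 - W.b1 * g.2, g.1 * V.b2 - W.b2 * g.2)
  map_add' g h := by
    ext <;> simp [Matrix.add_mul, Matrix.mul_add] <;> ring
  map_smul' c g := by
    ext <;> simp [mul_sub]

theorem isHom_of_homMap_eq_zero {V W : ARep} (hV1 : V.a1 = 0) (hV2 : V.a2 = 0)
    (hW1 : W.a1 = 0) (hW2 : W.a2 = 0) {g} (hg : homMap V W g = 0) :
    V.IsHom W g.1.mulVecLin g.2.mulVecLin := by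
  have h1 : g.1 * V.b1 = W.b1 * g.2 := sub_eq_zero.1 (congrArg Prod.fst hg)
  have h2 : g.1 * V.b2 = W.b2 * g.2 := sub_eq_zero.1 (congrArg Prod.snd hg)
  constructor <;> intro x <;> simp [hV1, hV2, hW1, hW2, h1, h2]

theorem finrank_ker_homMap_add (V W : ARep) :
    W.d0 * V.d0 + W.d1 * V.d1 ≤
      Module.finrank ℂ (LinearMap.ker (homMap V W)) + 2 * (W.d0 * V.d1) := by
  have h := LinearMap.finrank_range_add_finrank_ker (homMap V W)
  have h' := Submodule.finrank_le (LinearMap.range (homMap V W))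
  simp only [Module.finrank_prod, Module.finrank_matrix, Fintype.card_fin,
    Module.finrank_self, mul_one] at h h'
  omega

theorem mulVecLin_eq_zero {m n : ℕ} {M : Matrix (Fin m) (Fin n) ℂ} (h : M.mulVecLin = 0) :
    M = 0 := by
  apply Matrix.mulVec_injective
  funext x
  simpa using LinearMap.congr_fun h x

/-- Stable modules with vanishing `a`-arrows and real root dimension vector are unique. -/
theorem aEquiv_of_stable {V W : ARep} (hV : V.SlopeStable) (hW : W.SlopeStable)
    (hV1 : V.a1 = 0) (hV2 : V.a2 = 0) (hW1 : W.a1 = 0) (hW2 : W.a2 = 0)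
    (e0 : V.d0 = W.d0) (e1 : V.d1 = W.d1) (hd : V.d0 ≠ V.d1) : AEquiv V W := by
  have h := finrank_ker_homMap_add V W
  have hpos : LinearMap.ker (homMap V W) ≠ ⊥ := by
    intro h0
    rw [h0, finrank_bot, ← e0, ← e1] at h
    rcases Nat.lt_or_gt_of_ne hd with hlt | hlt <;> nlinarith
  obtain ⟨g, hg, hne⟩ := Submodule.exists_mem_ne_zero_of_ne_bot hpos
  refine (isHom_of_homMap_eq_zero hV1 hV2 hW1 hW2 hg).aEquiv hV hW e0 e1 fun h0 => hne ?_
  exact Prod.ext (mulVecLin_eq_zero h0.1) (mulVecLin_eq_zero h0.2)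

theorem dim_sub_le_one (V : ARep) (hV : V.SlopeStable) (hd : 0 < V.d0 + V.d1)
    (h1 : V.a1 = 0) (h2 : V.a2 = 0) : V.d0 ≤ V.d1 + 1 ∧ V.d1 ≤ V.d0 + 1 := by
  have h := finrank_ker_homMap_add V V
  have hle : LinearMap.ker (homMap V V) ≤
      Submodule.span ℂ {((1, 1) : Matrix _ _ ℂ × Matrix _ _ ℂ)} := by
    intro g hg
    obtain ⟨c, c0, c1⟩ := (isHom_of_homMap_eq_zero h1 h2 h1 h2 hg).exists_eq_smul_id hV hd
    refine Submodule.mem_span_singleton.2 ⟨c, Prod.ext ?_ ?_⟩ <;>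
      apply Matrix.mulVec_injective <;> funext x
    · simpa [Matrix.smul_mulVec] using (LinearMap.congr_fun c0 x).symm
    · simpa [Matrix.smul_mulVec] using (LinearMap.congr_fun c1 x).symm
  have hle' := (Submodule.finrank_mono hle).trans (finrank_span_le_card _)
  simp only [Set.toFinset_singleton, Finset.card_singleton] at hle'
  constructor <;> by_contra! hlt <;> nlinarith

theorem exists_common_line (V : ARep) (hd : V.d0 = V.d1) (hpos : 0 < V.d1) :
    ∃ v : Fin V.d1 → ℂ, v ≠ 0 ∧ ∃ w : Fin V.d0 → ℂ,
      V.b1 *ᵥ v ∈ Submodule.span ℂ {w} ∧ V.b2 *ᵥ v ∈ Submodule.span ℂ {w} := by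
  by_cases hi : Function.Injective V.b1.mulVecLin
  · let e := V.b1.mulVecLin.linearEquivOfInjective hi (by simpa using hd.symm)
    have he : ∀ x, e x = V.b1 *ᵥ x := fun x => rfl
    have : NeZero V.d1 := ⟨by omega⟩
    obtain ⟨c, hc⟩ := Module.End.exists_eigenvalue (e.symm.toLinearMap ∘ₗ V.b2.mulVecLin)
    obtain ⟨v, hv⟩ := hc.exists_hasEigenvector
    refine ⟨v, hv.2, V.b1 *ᵥ v, Submodule.mem_span_singleton_self _,
      Submodule.mem_span_singleton.2 ⟨c, ?_⟩⟩
    rw [← he, ← map_smul, ← hv.apply_eq_smul]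
    simp
  · obtain ⟨v, hv, hne⟩ := Submodule.exists_mem_ne_zero_of_ne_bot
      (fun h => hi (LinearMap.ker_eq_bot.1 h))
    refine ⟨v, hne, V.b2 *ᵥ v, ?_, Submodule.mem_span_singleton_self _⟩
    have : V.b1 *ᵥ v = 0 := hv
    rw [this]
    exact zero_mem _

theorem dim_eq_one_of_dim_eq (V : ARep) (hV : V.SlopeStable) (hd : 0 < V.d0 + V.d1)
    (h1 : V.a1 = 0) (h2 : V.a2 = 0) (he : V.d0 = V.d1) : V.d1 = 1 := by
  obtain ⟨v, hv, w, hw1, hw2⟩ := V.exists_common_line he (by omega)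
  have hB : ∀ b : Matrix (Fin V.d0) (Fin V.d1) ℂ, b *ᵥ v ∈ Submodule.span ℂ {w} →
      ∀ y ∈ Submodule.span ℂ {v}, b *ᵥ y ∈ Submodule.span ℂ {w} := by
    intro b hb y hy
    obtain ⟨s, rfl⟩ := Submodule.mem_span_singleton.1 hy
    rw [Matrix.mulVec_smul]
    exact Submodule.smul_mem _ _ hb
  let S : ASub V := ⟨Submodule.span ℂ {w}, Submodule.span ℂ {v}, fun x _ => by simp [h1],
    fun x _ => by simp [h2], hB _ hw1, hB _ hw2⟩
  have s1 : S.dim1 = 1 := finrank_span_singleton hv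
  have s0 : S.dim0 ≤ 1 := (finrank_span_le_card _).trans (by simp)
  by_contra hne
  have := hV S (by rw [S.isBot_iff]; omega) (by rw [S.isTop_iff]; omega)
  rw [s1, he] at this
  nlinarith

/-- A stable module has dimension vector `(1, 1)`, or its `a`-arrows vanish and its dimension
vector is `(m, m ± 1)`. -/
theorem SlopeStable.classification {V : ARep} (hV : V.SlopeStable) (hd : 0 < V.d0 + V.d1) :
    (V.d0 = 1 ∧ V.d1 = 1) ∨
      ((V.d0 = V.d1 + 1 ∨ V.d1 = V.d0 + 1) ∧ V.a1 = 0 ∧ V.a2 = 0) := by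
  by_cases h11 : V.d0 = 1 ∧ V.d1 = 1
  · exact .inl h11
  have key : ∀ {a b}, (a = V.a1 ∨ a = V.a2) → (b = V.b1 ∨ b = V.b2) → b * a = 0 := by
    intro a b ha hb
    obtain ⟨c, hba, hab⟩ := V.exists_central_eq_smul hV hd ha hb
    by_cases hc : c = 0
    · rw [hba, hc, zero_smul]
    · exact absurd (V.dim_eq_one_of_central_ne_zero hV hd ha hb hc hba hab) h11
  obtain ⟨z1, z2⟩ := V.a_eq_zero_of_central_eq_zero hV (key (.inl rfl) (.inl rfl))
    (key (.inr rfl) (.inl rfl)) (key (.inl rfl) (.inr rfl)) (key (.inr rfl) (.inr rfl))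
  obtain ⟨l1, l2⟩ := V.dim_sub_le_one hV hd z1 z2
  have := V.dim_eq_one_of_dim_eq hV hd z1 z2
  exact .inr ⟨by omega, z1, z2⟩

end ARep

/-- Forgetting the last coordinate. -/
def truncMatrix (n : ℕ) : Matrix (Fin n) (Fin (n + 1)) ℂ :=
  Matrix.of fun i j => if j = i.castSucc then 1 else 0

/-- Forgetting the first coordinate. -/
def shiftMatrix (n : ℕ) : Matrix (Fin n) (Fin (n + 1)) ℂ :=
  Matrix.of fun i j => if j = i.succ then 1 else 0

theorem truncMatrix_mulVec {n : ℕ} (x : Fin (n + 1) → ℂ) (i : Fin n) :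
    (truncMatrix n *ᵥ x) i = x i.castSucc := by
  simp [truncMatrix, Matrix.mulVec, dotProduct]

theorem shiftMatrix_mulVec {n : ℕ} (x : Fin (n + 1) → ℂ) (i : Fin n) :
    (shiftMatrix n *ᵥ x) i = x i.succ := by
  simp [shiftMatrix, Matrix.mulVec, dotProduct]

theorem truncMatrix_transpose_mulVec_castSucc {n : ℕ} (x : Fin n → ℂ) (j : Fin n) :
    ((truncMatrix n)ᵀ *ᵥ x) j.castSucc = x j := by
  simp [truncMatrix, Matrix.mulVec, dotProduct]

theorem truncMatrix_transpose_mulVec_last {n : ℕ} (x : Fin n → ℂ) :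
    ((truncMatrix n)ᵀ *ᵥ x) (Fin.last n) = 0 := by
  simp [truncMatrix, Matrix.mulVec, dotProduct, (Fin.castSucc_lt_last _).ne']

theorem shiftMatrix_transpose_mulVec_succ {n : ℕ} (x : Fin n → ℂ) (j : Fin n) :
    ((shiftMatrix n)ᵀ *ᵥ x) j.succ = x j := by
  simp [shiftMatrix, Matrix.mulVec, dotProduct]

theorem truncMatrix_transpose_injective (n : ℕ) :
    Function.Injective (truncMatrix n)ᵀ.mulVecLin := by
  intro x y h
  funext j
  have := congrFun h j.castSucc
  simpa only [Matrix.mulVecLin_apply, truncMatrix_transpose_mulVec_castSucc] using this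

/-- A nonzero space of polynomials of degree `< n` grows under multiplication by `1` and `x`. -/
theorem finrank_lt_of_transpose_mem {n : ℕ} {S0 : Submodule ℂ (Fin (n + 1) → ℂ)}
    {S1 : Submodule ℂ (Fin n → ℂ)} (hb1 : ∀ y ∈ S1, (truncMatrix n)ᵀ *ᵥ y ∈ S0)
    (hb2 : ∀ y ∈ S1, (shiftMatrix n)ᵀ *ᵥ y ∈ S0) (h1 : S1 ≠ ⊥) :
    Module.finrank ℂ S1 < Module.finrank ℂ S0 := by
  by_contra! hle
  have hmap : S1.map (truncMatrix n)ᵀ.mulVecLin = S0 := by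
    refine Submodule.eq_of_le_of_finrank_le ?_ ?_
    · rintro _ ⟨y, hy, rfl⟩
      exact hb1 y hy
    · rw [(Submodule.equivMapOfInjective _ (truncMatrix_transpose_injective n) S1).symm.finrank_eq]
      exact hle
  refine h1 ((Submodule.eq_bot_iff _).2 ?_)
  have key : ∀ k : ℕ, ∀ j : Fin n, n ≤ j + k → ∀ y ∈ S1, y j = 0 := by
    intro k
    induction k with
    | zero => intro j hj; omega
    | succ k ih =>
      intro j hj y hy
      obtain ⟨z, hz, hzy⟩ := hmap.ge (hb2 y hy)
      rw [← shiftMatrix_transpose_mulVec_succ y j, ← hzy, Matrix.mulVecLin_apply]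
      rcases Fin.eq_castSucc_or_eq_last j.succ with ⟨i, hi⟩ | hi
      · rw [hi, truncMatrix_transpose_mulVec_castSucc]
        refine ih i ?_ z hz
        have := congrArg Fin.val hi
        simp only [Fin.val_succ, Fin.val_castSucc] at this
        omega
      · rw [hi, truncMatrix_transpose_mulVec_last]
  intro y hy
  funext j
  exact key n j (by omega) y hy

theorem eq_smul_single_last {n : ℕ} {x : Fin (n + 1) → ℂ} (h : ∀ i : Fin n, x i.castSucc = 0) :
    x = x (Fin.last n) • Pi.single (Fin.last n) (1 : ℂ) := by
  funext i
  refine Fin.lastCases ?_ (fun i => ?_) i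
  · simp
  · simp [h, (Fin.castSucc_lt_last _).ne]

/-- A proper subspace does not shrink under the truncation and the shift. -/
theorem finrank_le_of_mem {n : ℕ} {S0 : Submodule ℂ (Fin n → ℂ)}
    {S1 : Submodule ℂ (Fin (n + 1) → ℂ)} (hb1 : ∀ y ∈ S1, truncMatrix n *ᵥ y ∈ S0)
    (hb2 : ∀ y ∈ S1, shiftMatrix n *ᵥ y ∈ S0) (h1 : S1 ≠ ⊤) :
    Module.finrank ℂ S1 ≤ Module.finrank ℂ S0 := by
  by_contra! hlt
  let e : Fin (n + 1) → Fin (n + 1) → ℂ := fun i => Pi.single i 1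
  let f : S1 →ₗ[ℂ] S0 := (truncMatrix n).mulVecLin.restrict hb1
  have hf : ∀ y : S1, f y = 0 → y.1 = y.1 (Fin.last n) • e (Fin.last n) := by
    intro y hy
    refine eq_smul_single_last fun i => ?_
    exact (truncMatrix_mulVec _ i).symm.trans (congrFun (congrArg Subtype.val hy) i)
  have hlast : e (Fin.last n) ∈ S1 := by
    obtain ⟨y, hy, hne⟩ := Submodule.exists_mem_ne_zero_of_ne_bot
      (LinearMap.ker_ne_bot_of_finrank_lt (f := f) hlt)
    have h := hf y hy
    have hc : y.1 (Fin.last n) ≠ 0 := by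
      intro h0
      rw [h0, zero_smul] at h
      exact hne (Subtype.ext h)
    refine (Submodule.smul_mem_iff _ hc).1 ?_
    rw [← h]
    exact y.2
  have hker : Module.finrank ℂ (LinearMap.ker f) ≤ 1 := by
    refine (Submodule.finrank_mono (t := Submodule.span ℂ {⟨_, hlast⟩}) ?_).trans
      ((finrank_span_le_card _).trans (by simp))
    intro y hy
    exact Submodule.mem_span_singleton.2 ⟨_, Subtype.ext (hf y hy).symm⟩
  have hsurj : Function.Surjective f := by
    rw [← LinearMap.range_eq_top]
    apply Submodule.eq_top_of_finrank_eq
    have h := LinearMap.finrank_range_add_finrank_ker f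
    have h' := Submodule.finrank_le (LinearMap.range f)
    omega
  have key : ∀ i : Fin (n + 1), e i ∈ S1 := by
    intro i
    induction i using Fin.reverseInduction with
    | last => exact hlast
    | cast i ih =>
      obtain ⟨⟨y, hy⟩, hyi⟩ := hsurj ⟨_, hb2 _ ih⟩
      have hy' : ∀ j : Fin n, y j.castSucc = e i.succ j.succ := by
        intro j
        exact (truncMatrix_mulVec y j).symm.trans
          ((congrFun (congrArg Subtype.val hyi) j).trans (shiftMatrix_mulVec _ j))
      have hsub : y - e i.castSucc = (y - e i.castSucc) (Fin.last n) • e (Fin.last n) := by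
        refine eq_smul_single_last fun j => ?_
        simp [hy', e, Pi.single_apply]
      have : e i.castSucc = y - (y - e i.castSucc) (Fin.last n) • e (Fin.last n) := by
        rw [← hsub, sub_sub_cancel]
      rw [this]
      exact S1.sub_mem hy (S1.smul_mem _ hlast)
  refine h1 (Submodule.eq_top_iff'.2 fun x => ?_)
  rw [pi_eq_sum_univ' x]
  exact S1.sum_mem fun i _ => S1.smul_mem _ (key i)

theorem truncMatrix_surjective (n : ℕ) (x : Fin n → ℂ) : ∃ y, truncMatrix n *ᵥ y = x :=
  ⟨Fin.snoc (α := fun _ => ℂ) x 0, funext fun i => by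
    rw [truncMatrix_mulVec, Fin.snoc_castSucc]⟩

namespace ARep

/-- The module `C^-_+(n + 1)`: the two inclusions, by multiplication by `1` and by `x`, of
polynomials of degree `< n` into polynomials of degree `≤ n`. -/
def cPlus (n : ℕ) : ARep :=
  ⟨n + 1, n, 0, 0, (truncMatrix n)ᵀ, (shiftMatrix n)ᵀ, by simp, by simp, by simp, by simp⟩

/-- The module `C^-_-(n)`, whose arrows are the transposes of those of `cPlus n`. -/
def cMinus (n : ℕ) : ARep :=
  ⟨n, n + 1, 0, 0, truncMatrix n, shiftMatrix n, by simp, by simp, by simp, by simp⟩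

theorem cPlus_slopeStable (n : ℕ) : (cPlus n).SlopeStable := by
  intro S hb ht
  have l0 : S.dim0 ≤ n + 1 := S.dim0_le
  have l1 : S.dim1 ≤ n := S.dim1_le
  change S.dim1 * (n + 1) < S.dim0 * n
  have ht' : ¬ (S.dim0 = n + 1 ∧ S.dim1 = n) := fun h => ht (S.isTop_iff.2 h)
  rw [S.isBot_iff] at hb
  by_cases h1 : S.S1 = ⊥
  · have h0 : S.dim1 = 0 := by rw [ASub.dim1, h1, finrank_bot]
    have : 0 < n := by omega
    rw [h0, zero_mul]
    exact Nat.mul_pos (by omega) this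
  · have : S.dim1 < S.dim0 := finrank_lt_of_transpose_mem S.hb1 S.hb2 h1
    have : S.dim1 < n := by omega
    nlinarith

theorem cMinus_slopeStable (n : ℕ) : (cMinus n).SlopeStable := by
  intro S hb ht
  change S.dim1 * n < S.dim0 * (n + 1)
  by_cases h1 : S.S1 = ⊤
  · refine absurd ⟨Submodule.eq_top_iff'.2 fun x => ?_, h1⟩ ht
    obtain ⟨y, rfl⟩ := truncMatrix_surjective n x
    exact S.hb1 y (h1 ▸ trivial)
  · have : S.dim1 ≤ S.dim0 := finrank_le_of_mem S.hb1 S.hb2 h1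
    rw [S.isBot_iff] at hb
    nlinarith [show 0 < S.dim0 by omega]

/-- The module of dimension vector `(1, 1)` with the given arrows. -/
def ofScalars (α β : Fin 2 → ℂ) : ARep where
  d0 := 1
  d1 := 1
  a1 := α 0 • (1 : Matrix (Fin 1) (Fin 1) ℂ)
  a2 := α 1 • (1 : Matrix (Fin 1) (Fin 1) ℂ)
  b1 := β 0 • (1 : Matrix (Fin 1) (Fin 1) ℂ)
  b2 := β 1 • (1 : Matrix (Fin 1) (Fin 1) ℂ)
  rel1 := by simp [smul_smul, mul_comm, mul_assoc]
  rel2 := by simp [smul_smul, mul_comm, mul_left_comm]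
  rel3 := by simp [smul_smul, mul_comm, mul_assoc, mul_left_comm]
  rel4 := by simp [smul_smul, mul_comm, mul_left_comm]

/-- The scalars by which the arrows `a1`, `a2` act, for a module of dimension vector `(1, 1)`. -/
def aVec (V : ARep) : Fin 2 → ℂ := ![∑ i, ∑ j, V.a1 i j, ∑ i, ∑ j, V.a2 i j]

/-- The scalars by which the arrows `b1`, `b2` act, for a module of dimension vector `(1, 1)`. -/
def bVec (V : ARep) : Fin 2 → ℂ := ![∑ i, ∑ j, V.b1 i j, ∑ i, ∑ j, V.b2 i j]

theorem sum_sum_smul_one (c : ℂ) :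
    ∑ i, ∑ j, (c • (1 : Matrix (Fin 1) (Fin 1) ℂ)) i j = c := by
  simp

theorem aVec_ofScalars (α β : Fin 2 → ℂ) : (ofScalars α β).aVec = α := by
  funext i
  fin_cases i <;> exact sum_sum_smul_one _

theorem bVec_ofScalars (α β : Fin 2 → ℂ) : (ofScalars α β).bVec = β := by
  funext i
  fin_cases i <;> exact sum_sum_smul_one _

theorem exists_eq_ofScalars {V : ARep} (h0 : V.d0 = 1) (h1 : V.d1 = 1) :
    ∃ α β, V = ofScalars α β := by
  obtain ⟨d0, d1, a1, a2, b1, b2, _, _, _, _⟩ := V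
  dsimp only at h0 h1
  subst h0 h1
  refine ⟨![a1 0 0, a2 0 0], ![b1 0 0, b2 0 0], ?_⟩
  simp only [ofScalars, mk.injEq, heq_eq_eq, true_and]
  refine ⟨?_, ?_, ?_, ?_⟩ <;> ext i j <;> simp [Subsingleton.elim i 0, Subsingleton.elim j 0]

theorem ofScalars_slopeStable_iff (α β : Fin 2 → ℂ) :
    (ofScalars α β).SlopeStable ↔ β ≠ 0 := by
  constructor
  · rintro h rfl
    have hz : ∀ (i : Fin 2) (y : Fin 1 → ℂ),
        ((0 : Fin 2 → ℂ) i • (1 : Matrix (Fin 1) (Fin 1) ℂ)) *ᵥ y ∈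
          (⊥ : Submodule ℂ (Fin 1 → ℂ)) := fun i y => by simp
    let S : ASub (ofScalars α 0) := ⟨⊥, ⊤, fun _ _ => trivial, fun _ _ => trivial,
      fun y _ => hz 0 y, fun y _ => hz 1 y⟩
    have s0 : S.dim0 = 0 := finrank_bot ℂ _
    have s1 : S.dim1 = 1 := (finrank_top ℂ _).trans (Module.finrank_fin_fun ℂ)
    have := h S (by rw [S.isBot_iff]; omega) (by
      rw [S.isTop_iff, s0]; exact fun h => zero_ne_one h.1)
    rw [s0, s1] at this
    simp [ofScalars] at this
  · intro hβ S hb ht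
    change S.dim1 * 1 < S.dim0 * 1
    have l0 : S.dim0 ≤ 1 := S.dim0_le
    have l1 : S.dim1 ≤ 1 := S.dim1_le
    rw [S.isBot_iff] at hb
    have ht' : ¬ (S.dim0 = 1 ∧ S.dim1 = 1) := fun h => ht (S.isTop_iff.2 h)
    by_contra hlt
    have s0 : S.S0 = ⊥ := Submodule.finrank_eq_zero.1 (show S.dim0 = 0 by omega)
    have s1 : S.S1 = ⊤ := Submodule.eq_top_of_finrank_eq
      ((show S.dim1 = 1 by omega).trans (Module.finrank_fin_fun ℂ).symm)
    have h1 : (β 0 • (1 : Matrix (Fin 1) (Fin 1) ℂ)) *ᵥ 1 = 0 :=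
      (Submodule.mem_bot ℂ).1 (s0.le (S.hb1 _ (s1.ge trivial)))
    have h2 : (β 1 • (1 : Matrix (Fin 1) (Fin 1) ℂ)) *ᵥ 1 = 0 :=
      (Submodule.mem_bot ℂ).1 (s0.le (S.hb2 _ (s1.ge trivial)))
    refine hβ (funext fun i => ?_)
    fin_cases i
    · simpa [Matrix.smul_mulVec] using congrFun h1 0
    · simpa [Matrix.smul_mulVec] using congrFun h2 0

theorem smul_one_mulVec (c : ℂ) (x : Fin 1 → ℂ) :
    (c • (1 : Matrix (Fin 1) (Fin 1) ℂ)) *ᵥ x = c • x := by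
  rw [Matrix.smul_mulVec, Matrix.one_mulVec]

theorem aEquiv_ofScalars_iff (α β α' β' : Fin 2 → ℂ) :
    AEquiv (ofScalars α β) (ofScalars α' β') ↔ ∃ t : ℂ, t ≠ 0 ∧ β' = t • β ∧ α = t • α' := by
  have key : AEquiv (ofScalars α β) (ofScalars α' β') ↔
      ∃ g0 g1 : (Fin 1 → ℂ) ≃ₗ[ℂ] (Fin 1 → ℂ),
        (∀ x, g1 ((α 0 • (1 : Matrix (Fin 1) (Fin 1) ℂ)) *ᵥ x) =
          (α' 0 • (1 : Matrix (Fin 1) (Fin 1) ℂ)) *ᵥ g0 x) ∧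
        (∀ x, g1 ((α 1 • (1 : Matrix (Fin 1) (Fin 1) ℂ)) *ᵥ x) =
          (α' 1 • (1 : Matrix (Fin 1) (Fin 1) ℂ)) *ᵥ g0 x) ∧
        (∀ y, g0 ((β 0 • (1 : Matrix (Fin 1) (Fin 1) ℂ)) *ᵥ y) =
          (β' 0 • (1 : Matrix (Fin 1) (Fin 1) ℂ)) *ᵥ g1 y) ∧
        (∀ y, g0 ((β 1 • (1 : Matrix (Fin 1) (Fin 1) ℂ)) *ᵥ y) =
          (β' 1 • (1 : Matrix (Fin 1) (Fin 1) ℂ)) *ᵥ g1 y) := Iff.rfl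
  simp only [smul_one_mulVec, map_smul] at key
  rw [key]
  constructor
  · rintro ⟨g0, g1, h1, h2, h3, h4⟩
    have hg : ∀ g : (Fin 1 → ℂ) ≃ₗ[ℂ] (Fin 1 → ℂ), g 1 0 ≠ 0 := by
      intro g h
      have : g 1 = 0 := by
        funext i
        rw [Subsingleton.elim i 0, h, Pi.zero_apply]
      exact one_ne_zero (g.map_eq_zero_iff.1 this)
    have n0 := hg g0
    have n1 := hg g1
    have h1 := congrFun (h1 1) 0
    have h2 := congrFun (h2 1) 0
    have h3 := congrFun (h3 1) 0
    have h4 := congrFun (h4 1) 0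
    simp only [Pi.smul_apply, smul_eq_mul] at h1 h2 h3 h4
    refine ⟨g0 1 0 / g1 1 0, div_ne_zero n0 n1, ?_, ?_⟩ <;> funext i <;> fin_cases i <;>
      simp only [Fin.zero_eta, Fin.mk_one, Pi.smul_apply, smul_eq_mul] <;> field_simp
    · linear_combination -h3
    · linear_combination -h4
    · linear_combination h1
    · linear_combination h2
  · rintro ⟨t, ht, rfl, rfl⟩
    have hs : ∀ x, LinearEquiv.smulOfNeZero ℂ (Fin 1 → ℂ) t ht x = t • x := fun _ => rfl
    refine ⟨LinearEquiv.smulOfNeZero ℂ _ t ht, LinearEquiv.refl ℂ _, ?_, ?_, ?_, ?_⟩ <;>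
      intro x <;> simp [hs, smul_smul, mul_comm]

theorem bVec_ne_zero {V : ARep} (hV : V.SlopeStable) (h0 : V.d0 = 1) (h1 : V.d1 = 1) :
    V.bVec ≠ 0 := by
  obtain ⟨α, β, rfl⟩ := exists_eq_ofScalars h0 h1
  rw [bVec_ofScalars]
  exact (ofScalars_slopeStable_iff α β).1 hV

theorem aEquiv_iff_of_dim_eq_one {V W : ARep} (hV0 : V.d0 = 1) (hV1 : V.d1 = 1)
    (hW0 : W.d0 = 1) (hW1 : W.d1 = 1) :
    AEquiv V W ↔ ∃ t : ℂ, t ≠ 0 ∧ W.bVec = t • V.bVec ∧ V.aVec = t • W.aVec := by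
  obtain ⟨α, β, rfl⟩ := exists_eq_ofScalars hV0 hV1
  obtain ⟨α', β', rfl⟩ := exists_eq_ofScalars hW0 hW1
  simp only [aVec_ofScalars, bVec_ofScalars, aEquiv_ofScalars_iff]

end ARep

/-- The point of the resolved conifold attached to a stable module of dimension vector `(1, 1)`:
the line spanned by `(b1, b2)`, with its points `a1 (b1, b2)` and `a2 (b1, b2)`. -/
def resolvedConifoldPoint {ζ : ℝ × ℝ} (h : ζ.1 < ζ.2)
    (V : {V : ARep // IsStableA ζ V ∧ V.d0 = 1 ∧ V.d1 = 1}) : ResolvedConifold :=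
  ⟨(Submodule.span ℂ {V.1.bVec}, V.1.aVec 0 • V.1.bVec, V.1.aVec 1 • V.1.bVec),
    finrank_span_singleton
      (ARep.bVec_ne_zero ((isStableA_iff_slopeStable h _).1 V.2.1) V.2.2.1 V.2.2.2),
    Submodule.smul_mem _ _ (Submodule.mem_span_singleton_self _),
    Submodule.smul_mem _ _ (Submodule.mem_span_singleton_self _)⟩

theorem resolvedConifoldPoint_eq_iff {ζ : ℝ × ℝ} (h : ζ.1 < ζ.2)
    (V W : {V : ARep // IsStableA ζ V ∧ V.d0 = 1 ∧ V.d1 = 1}) :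
    resolvedConifoldPoint h V = resolvedConifoldPoint h W ↔ AEquiv V.1 W.1 := by
  rw [ARep.aEquiv_iff_of_dim_eq_one V.2.2.1 V.2.2.2 W.2.2.1 W.2.2.2]
  have hV := ARep.bVec_ne_zero ((isStableA_iff_slopeStable h _).1 V.2.1) V.2.2.1 V.2.2.2
  have hW := ARep.bVec_ne_zero ((isStableA_iff_slopeStable h _).1 W.2.1) W.2.2.1 W.2.2.2
  refine Subtype.ext_iff.trans ?_
  simp only [resolvedConifoldPoint, Prod.mk.injEq]
  constructor
  · rintro ⟨hs, hp, hq⟩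
    obtain ⟨t, ht⟩ := Submodule.mem_span_singleton.1
      (hs.ge (Submodule.mem_span_singleton_self W.1.bVec))
    refine ⟨t, fun h0 => hW ?_, ht.symm, funext fun i => ?_⟩
    · rw [← ht, h0, zero_smul]
    · rw [← ht, smul_smul] at hp hq
      have hp := smul_left_injective ℂ hV hp
      have hq := smul_left_injective ℂ hV hq
      fin_cases i
      · simpa [mul_comm] using hp
      · simpa [mul_comm] using hq
  · rintro ⟨t, ht, hb, ha⟩
    rw [hb, ha]
    refine ⟨(Submodule.span_singleton_smul_eq (IsUnit.mk0 t ht) _).symm, ?_, ?_⟩ <;>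
      simp [smul_smul, mul_comm]

theorem resolvedConifoldPoint_surjective {ζ : ℝ × ℝ} (h : ζ.1 < ζ.2) :
    Function.Surjective (resolvedConifoldPoint h) := by
  rintro ⟨⟨l, p, q⟩, hl, hp, hq⟩
  obtain ⟨⟨v, hv⟩, hv0, hspan⟩ := finrank_eq_one_iff'.1 hl
  obtain ⟨s, hs⟩ := hspan ⟨p, hp⟩
  obtain ⟨t, ht⟩ := hspan ⟨q, hq⟩
  have hs' : s • v = p := congrArg Subtype.val hs
  have ht' : t • v = q := congrArg Subtype.val ht
  have hl' : Submodule.span ℂ {v} = l := by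
    refine le_antisymm ((Submodule.span_singleton_le_iff_mem _ _).2 hv) fun x hx => ?_
    obtain ⟨c, hc⟩ := hspan ⟨x, hx⟩
    exact Submodule.mem_span_singleton.2 ⟨c, congrArg Subtype.val hc⟩
  refine ⟨⟨ARep.ofScalars ![s, t] v, (isStableA_iff_slopeStable h _).2
    ((ARep.ofScalars_slopeStable_iff _ _).2 fun h0 => hv0 (Subtype.ext h0)), rfl, rfl⟩, ?_⟩
  apply Subtype.ext
  simp [resolvedConifoldPoint, ARep.aVec_ofScalars, ARep.bVec_ofScalars, hs', ht', hl']

/-- The moduli space of stable modules of dimension vector `(1, 1)`. -/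
noncomputable def stableOneOneEquiv {ζ : ℝ × ℝ} (h : ζ.1 < ζ.2) :
    StableOneOne ζ ≃ ResolvedConifold :=
  Equiv.ofBijective
    (Quot.lift (resolvedConifoldPoint h) fun V W => (resolvedConifoldPoint_eq_iff h V W).2)
    ⟨by
      rintro ⟨V⟩ ⟨W⟩ hVW
      exact Quot.sound ((resolvedConifoldPoint_eq_iff h V W).1 hVW),
    fun x => (resolvedConifoldPoint_surjective h x).imp' (Quot.mk _) fun _ hV => hV⟩

/-- Exchanging the two vertices of the quiver. -/
def ARep.swap (V : ARep) : ARep :=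
  ⟨V.d1, V.d0, V.b1, V.b2, V.a1, V.a2, V.rel3, V.rel4, V.rel1, V.rel2⟩

theorem IsStableA.swap {ζ : ℝ × ℝ} {V : ARep} (h : IsStableA ζ V) :
    IsStableA ζ.swap V.swap := by
  intro S hb ht
  have := h ⟨S.S1, S.S0, S.hb1, S.hb2, S.ha1, S.ha2⟩ (fun h => hb h.symm) (fun h => ht h.symm)
  have key : ∀ n0 n1, theta ζ.swap n1 n0 = theta ζ n0 n1 := fun n0 n1 => by
    rw [theta, theta, Prod.fst_swap, Prod.snd_swap, add_comm, add_comm (n1 : ℝ)]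
  exact ((key _ _).trans_lt this).trans_eq (key _ _).symm

theorem AEquiv.swap {V W : ARep} : AEquiv V W → AEquiv V.swap W.swap :=
  fun ⟨g0, g1, h1, h2, h3, h4⟩ => ⟨g1, g0, h3, h4, h1, h2⟩

/-- Exchanging the two vertices identifies the moduli spaces of stable modules of dimension
vector `(1, 1)`. -/
def stableOneOneSwap (ζ : ℝ × ℝ) : StableOneOne ζ ≃ StableOneOne ζ.swap :=
  Quot.congr
    { toFun := fun V => ⟨V.1.swap, V.2.1.swap, V.2.2.2, V.2.2.1⟩
      invFun := fun V => ⟨V.1.swap, V.2.1.swap, V.2.2.2, V.2.2.1⟩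
      left_inv := fun _ => rfl
      right_inv := fun _ => rfl }
    fun _ _ => ⟨AEquiv.swap, AEquiv.swap⟩

/-- **Classification of stable modules** (Nagao–Nakajima, Theorem 3.3).

(1) If `ζ0 < ζ1` then the `θ_ζ`-stable `A`-modules are exactly:
the modules `C^-_+(m)` (`m ≥ 1`), the unique stable modules with
`a1 = a2 = 0` and dimension vector `(m, m−1)`; the stable modules of
dimension vector `(1,1)`, which are parameterized by the resolved
conifold `Y`; and the modules `C^-_-(m)` (`m ≥ 0`), the unique stable
modules with `a1 = a2 = 0` and dimension vector `(m, m+1)`.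

(2) If `ζ0 > ζ1` the same holds with `b1 = b2 = 0` instead and with the
`(1,1)`-modules parameterized by the flop `Y⁺`. -/
theorem classification_of_stable_modules (ζ : ℝ × ℝ) :
    (ζ.1 < ζ.2 →
      (∀ W : ARep, 0 < W.d0 + W.d1 → IsStableA ζ W →
        (∃ m : ℕ, 1 ≤ m ∧ W.d0 = m ∧ W.d1 + 1 = m ∧ W.a1 = 0 ∧ W.a2 = 0) ∨
        (W.d0 = 1 ∧ W.d1 = 1) ∨
        (∃ m : ℕ, W.d0 = m ∧ W.d1 = m + 1 ∧ W.a1 = 0 ∧ W.a2 = 0)) ∧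
      (∀ m : ℕ, 1 ≤ m →
        (∃ W : ARep, IsStableA ζ W ∧ W.d0 = m ∧ W.d1 + 1 = m ∧
          W.a1 = 0 ∧ W.a2 = 0) ∧
        (∀ W W' : ARep, IsStableA ζ W → W.d0 = m → W.d1 + 1 = m →
          W.a1 = 0 → W.a2 = 0 →
          IsStableA ζ W' → W'.d0 = m → W'.d1 + 1 = m →
          W'.a1 = 0 → W'.a2 = 0 → AEquiv W W')) ∧
      (∀ m : ℕ,
        (∃ W : ARep, IsStableA ζ W ∧ W.d0 = m ∧ W.d1 = m + 1 ∧
          W.a1 = 0 ∧ W.a2 = 0) ∧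
        (∀ W W' : ARep, IsStableA ζ W → W.d0 = m → W.d1 = m + 1 →
          W.a1 = 0 → W.a2 = 0 →
          IsStableA ζ W' → W'.d0 = m → W'.d1 = m + 1 →
          W'.a1 = 0 → W'.a2 = 0 → AEquiv W W')) ∧
      Nonempty (StableOneOne ζ ≃ ResolvedConifold)) ∧
    (ζ.2 < ζ.1 →
      (∀ W : ARep, 0 < W.d0 + W.d1 → IsStableA ζ W →
        (∃ m : ℕ, 1 ≤ m ∧ W.d0 = m ∧ W.d1 + 1 = m ∧ W.b1 = 0 ∧ W.b2 = 0) ∨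
        (W.d0 = 1 ∧ W.d1 = 1) ∨
        (∃ m : ℕ, W.d0 = m ∧ W.d1 = m + 1 ∧ W.b1 = 0 ∧ W.b2 = 0)) ∧
      (∀ m : ℕ, 1 ≤ m →
        (∃ W : ARep, IsStableA ζ W ∧ W.d0 = m ∧ W.d1 + 1 = m ∧
          W.b1 = 0 ∧ W.b2 = 0) ∧
        (∀ W W' : ARep, IsStableA ζ W → W.d0 = m → W.d1 + 1 = m →
          W.b1 = 0 → W.b2 = 0 →
          IsStableA ζ W' → W'.d0 = m → W'.d1 + 1 = m →
          W'.b1 = 0 → W'.b2 = 0 → AEquiv W W')) ∧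
      (∀ m : ℕ,
        (∃ W : ARep, IsStableA ζ W ∧ W.d0 = m ∧ W.d1 = m + 1 ∧
          W.b1 = 0 ∧ W.b2 = 0) ∧
        (∀ W W' : ARep, IsStableA ζ W → W.d0 = m → W.d1 = m + 1 →
          W.b1 = 0 → W.b2 = 0 →
          IsStableA ζ W' → W'.d0 = m → W'.d1 = m + 1 →
          W'.b1 = 0 → W'.b2 = 0 → AEquiv W W')) ∧
      Nonempty (StableOneOne ζ ≃ ResolvedConifold)) := by
  constructor
  · intro h
    refine ⟨fun W hd hW => ?_, fun m hm => ⟨?_, ?_⟩, fun m => ⟨?_, ?_⟩, ⟨stableOneOneEquiv h⟩⟩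
    · rcases ((isStableA_iff_slopeStable h W).1 hW).classification hd with
        h11 | ⟨h0 | h0, ha⟩
      · exact .inr (.inl h11)
      · exact .inl ⟨W.d0, by omega, rfl, h0.symm, ha⟩
      · exact .inr (.inr ⟨W.d0, rfl, h0, ha⟩)
    · obtain ⟨n, rfl⟩ := Nat.exists_eq_add_of_le' hm
      exact ⟨ARep.cPlus n, (isStableA_iff_slopeStable h _).2 (ARep.cPlus_slopeStable n),
        rfl, rfl, rfl, rfl⟩
    · intro W W' hW h0 h1 ha1 ha2 hW' h0' h1' ha1' ha2'
      rw [isStableA_iff_slopeStable h] at hW hW'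
      exact ARep.aEquiv_of_stable hW hW' ha1 ha2 ha1' ha2' (by omega) (by omega) (by omega)
    · exact ⟨ARep.cMinus m, (isStableA_iff_slopeStable h _).2 (ARep.cMinus_slopeStable m),
        rfl, rfl, rfl, rfl⟩
    · intro W W' hW h0 h1 ha1 ha2 hW' h0' h1' ha1' ha2'
      rw [isStableA_iff_slopeStable h] at hW hW'
      exact ARep.aEquiv_of_stable hW hW' ha1 ha2 ha1' ha2' (by omega) (by omega) (by omega)
  · intro h
    have h' : ζ.swap.1 < ζ.swap.2 := h
    have hS : ∀ {V : ARep}, IsStableA ζ V → V.swap.SlopeStable := fun hV =>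
      (isStableA_iff_slopeStable h' _).1 hV.swap
    have hS' : ∀ {V : ARep}, V.SlopeStable → IsStableA ζ V.swap := fun {V} hV =>
      ((isStableA_iff_slopeStable h' V).2 hV).swap
    refine ⟨fun W hd hW => ?_, fun m hm => ⟨?_, ?_⟩, fun m => ⟨?_, ?_⟩,
      ⟨(stableOneOneSwap ζ).trans (stableOneOneEquiv h')⟩⟩
    · rcases (hS hW).classification (Nat.add_comm _ _ ▸ hd) with h11 | ⟨h0 | h0, hb⟩
      · exact .inr (.inl h11.symm)
      · exact .inr (.inr ⟨W.d0, rfl, h0, hb⟩)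
      · exact .inl ⟨W.d0, Nat.le.intro ((Nat.add_comm _ _).trans h0.symm), rfl, h0.symm, hb⟩
    · obtain ⟨n, rfl⟩ := Nat.exists_eq_add_of_le' hm
      exact ⟨(ARep.cMinus n).swap, hS' (ARep.cMinus_slopeStable n), rfl, rfl, rfl, rfl⟩
    · intro W W' hW h0 h1 hb1 hb2 hW' h0' h1' hb1' hb2'
      exact (ARep.aEquiv_of_stable (hS hW) (hS hW') hb1 hb2 hb1' hb2'
        (show W.d1 = W'.d1 by omega) (show W.d0 = W'.d0 by omega)
        (show W.d1 ≠ W.d0 by omega)).swap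
    · exact ⟨(ARep.cPlus m).swap, hS' (ARep.cPlus_slopeStable m), rfl, rfl, rfl, rfl⟩
    · intro W W' hW h0 h1 hb1 hb2 hW' h0' h1' hb1' hb2'
      exact (ARep.aEquiv_of_stable (hS hW) (hS hW') hb1 hb2 hb1' hb2'
        (show W.d1 = W'.d1 by omega) (show W.d0 = W'.d0 by omega)
        (show W.d1 ≠ W.d0 by omega)).swap
end
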